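/- arXiv:1108.6272 — 2 statements merged into one kernel-verified Lean document; each statement's English description precedes it below -/
import Mathlib

section
/- There exists a constant C > 0 such that for every real number X ≥ 1, the number of fundamental discriminants f with 0 < |f| ≤ X satisfies |#{f : f is a fundamental discriminant, 0 < |f| ≤ X} − (6/π²)·X| ≤ C·X^{1/2}. -/
/-- An integer `f` is a fundamental discriminant if either `f ≡ 1 (mod 4)` and `f` is
squarefree, or `f = 4m` with `m` squarefree and `m ≡ 2` or `3 (mod 4)`. -/
def IsFundamentalDiscriminant (f : ℤ) : Prop :=
  (f % 4 = 1 ∧ Squarefree f) ∨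
  (∃ m : ℤ, f = 4 * m ∧ Squarefree m ∧ (m % 4 = 2 ∨ m % 4 = 3))

open Finset in
/-- The number of squarefree positive integers up to `n`. -/
def squarefreeCount (n : ℕ) : ℤ := ∑ m ∈ Ioc 0 n, if Squarefree m then 1 else 0

open ArithmeticFunction ArithmeticFunction.Moebius in
/-- The indicator of squarefree numbers is `∑ μ(d)` over `d` with `d ^ 2 ∣ n`. -/
theorem sum_moebius_sq_dvd {n M : ℕ} (hn : 0 < n) (hM : n < (M + 1) ^ 2) :
    ∑ d ∈ Finset.Ioc 0 M, (if d ^ 2 ∣ n then μ d else 0) = if Squarefree n then 1 else 0 := by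
  obtain ⟨a, b, ha, hb, rfl, hsq⟩ := Nat.sq_mul_squarefree_of_pos hn
  have hdvd (d : ℕ) : d ^ 2 ∣ b ^ 2 * a ↔ d ∣ b := by
    refine ⟨fun h => ?_, fun h => (pow_dvd_pow_of_dvd h 2).mul_right a⟩
    have hd : d ≠ 0 := by rintro rfl; simp [ha.ne', hb.ne'] at h
    rw [← Nat.factorization_le_iff_dvd hd hb.ne']
    intro p
    have h1 := (Nat.factorization_le_iff_dvd (pow_ne_zero 2 hd) hn.ne').2 h p
    have h2 := hsq.natFactorization_le_one p
    rw [Nat.factorization_mul (pow_ne_zero 2 hb.ne') ha.ne'] at h1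
    simp only [Nat.factorization_pow, Finsupp.add_apply, Finsupp.smul_apply, smul_eq_mul] at h1
    omega
  have hset : (Finset.Ioc 0 M).filter (fun d => d ^ 2 ∣ b ^ 2 * a) = b.divisors := by
    ext d
    simp only [Finset.mem_filter, Finset.mem_Ioc, hdvd, Nat.mem_divisors]
    refine ⟨fun h => ⟨h.2, hb.ne'⟩, fun h => ⟨⟨Nat.pos_of_dvd_of_pos h.1 hb, ?_⟩, h.1⟩⟩
    have h1 := Nat.le_of_dvd hb h.1
    have h2 : b ^ 2 ≤ b ^ 2 * a := Nat.le_mul_of_pos_right _ ha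
    have h3 : b < M + 1 := lt_of_pow_lt_pow_left₀ 2 (by omega) (h2.trans_lt hM)
    omega
  have hb1 : Squarefree (b ^ 2 * a) ↔ b = 1 := by
    refine ⟨fun h => ?_, fun h => by simpa [h] using hsq⟩
    exact Nat.isUnit_iff.1 (h b ⟨a, by ring⟩)
  rw [← Finset.sum_filter, hset, ← coe_zeta_mul_apply, coe_zeta_mul_moebius, one_apply]
  simp [hb1]

/-- Sums over the multiples of `k` up to `n`. -/
theorem sum_Ioc_ite_dvd (g : ℕ → ℤ) {k : ℕ} (hk : 0 < k) (n : ℕ) :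
    ∑ m ∈ Finset.Ioc 0 n, (if k ∣ m then g (m / k) else 0) = ∑ m ∈ Finset.Ioc 0 (n / k), g m := by
  rw [← Finset.sum_filter]
  refine Finset.sum_nbij' (fun m => m / k) (fun m => k * m) ?_ ?_ ?_ ?_ ?_
  · intro m hm
    simp only [Finset.mem_filter, Finset.mem_Ioc] at hm ⊢
    exact ⟨Nat.div_pos (Nat.le_of_dvd hm.1.1 hm.2) hk, Nat.div_le_div_right hm.1.2⟩
  · intro m hm
    simp only [Finset.mem_filter, Finset.mem_Ioc] at hm ⊢
    refine ⟨⟨Nat.mul_pos hk hm.1, ?_⟩, dvd_mul_right k m⟩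
    rw [mul_comm]
    exact (Nat.le_div_iff_mul_le hk).1 hm.2
  · intro m hm
    exact Nat.mul_div_cancel' (Finset.mem_filter.1 hm).2
  · intro m _
    exact Nat.mul_div_cancel_left m hk
  · intro m _
    rfl

open ArithmeticFunction ArithmeticFunction.Moebius in
theorem squarefreeCount_eq_sum_moebius {n M : ℕ} (hM : n < (M + 1) ^ 2) :
    squarefreeCount n = ∑ d ∈ Finset.Ioc 0 M, μ d * ((n / d ^ 2 : ℕ) : ℤ) := by
  have h (m) (hm : m ∈ Finset.Ioc 0 n) : (if Squarefree m then (1 : ℤ) else 0) =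
      ∑ d ∈ Finset.Ioc 0 M, (if d ^ 2 ∣ m then μ d else 0) := by
    rw [Finset.mem_Ioc] at hm
    rw [sum_moebius_sq_dvd hm.1 (hm.2.trans_lt hM)]
  rw [squarefreeCount, Finset.sum_congr rfl h, Finset.sum_comm]
  refine Finset.sum_congr rfl fun d hd => ?_
  have hd0 : 0 < d := (Finset.mem_Ioc.1 hd).1
  rw [sum_Ioc_ite_dvd (fun _ => μ d) (pow_pos hd0 2)]
  simp [mul_comm]

open ArithmeticFunction ArithmeticFunction.Moebius in
theorem hasSum_moebius_div_sq :
    HasSum (fun d : ℕ => (μ d : ℝ) / (d : ℝ) ^ 2) (6 / Real.pi ^ 2) := by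
  have h2 : 1 < (2 : ℂ).re := by norm_num
  have hs := LSeriesSummable_moebius_iff.2 h2
  have hz := LSeries_zeta_mul_Lseries_moebius h2
  rw [LSeries_zeta_eq_riemannZeta h2, riemannZeta_two] at hz
  have hL := hs.LSeriesHasSum
  have hpi : (Real.pi : ℂ) ≠ 0 := by exact_mod_cast Real.pi_ne_zero
  have hval : LSeries (fun n => ((μ n : ℤ) : ℂ)) 2 = ((6 / Real.pi ^ 2 : ℝ) : ℂ) := by
    push_cast
    field_simp at hz ⊢
    linear_combination hz
  rw [hval] at hL
  rw [← Complex.hasSum_ofReal]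
  convert (show HasSum _ _ from hL) using 2 with d
  rcases eq_or_ne d 0 with rfl | hd
  · simp
  · rw [LSeries.term_of_ne_zero hd]
    norm_cast

open ArithmeticFunction ArithmeticFunction.Moebius in
theorem abs_sum_moebius_div_sq_sub_le {M : ℕ} (hM : M ≠ 0) :
    |∑ d ∈ Finset.Ioc 0 M, (μ d : ℝ) / (d : ℝ) ^ 2 - 6 / Real.pi ^ 2| ≤ (M : ℝ)⁻¹ := by
  have ht := (hasSum_moebius_div_sq.tendsto_sum_nat.comp (Filter.tendsto_add_atTop_nat 1))
  rw [abs_sub_comm]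
  refine le_of_tendsto (ht.sub_const _).abs ?_
  filter_upwards [Filter.eventually_ge_atTop M] with K hK
  have h0 : ∑ d ∈ Finset.range (K + 1), (μ d : ℝ) / (d : ℝ) ^ 2 =
      ∑ d ∈ Finset.Ioc 0 K, (μ d : ℝ) / (d : ℝ) ^ 2 := by
    rw [Finset.range_eq_Ico, Finset.sum_eq_sum_Ico_succ_bot (Nat.succ_pos K)]
    simp only [ArithmeticFunction.map_zero, Int.cast_zero, zero_div, zero_add]
    congr 1
  rw [Function.comp_apply, h0, ← Finset.sum_Ioc_consecutive _ (Nat.zero_le M) hK,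
    add_sub_cancel_left]
  calc |∑ d ∈ Finset.Ioc M K, (μ d : ℝ) / (d : ℝ) ^ 2|
      ≤ ∑ d ∈ Finset.Ioc M K, |(μ d : ℝ) / (d : ℝ) ^ 2| := Finset.abs_sum_le_sum_abs _ _
    _ ≤ ∑ d ∈ Finset.Ioc M K, ((d : ℝ) ^ 2)⁻¹ := by
        refine Finset.sum_le_sum fun d _ => ?_
        have hμ : |(μ d : ℝ)| ≤ 1 := by exact_mod_cast abs_moebius_le_one
        rw [abs_div, abs_of_nonneg (sq_nonneg (d : ℝ)), div_eq_mul_inv]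
        exact mul_le_of_le_one_left (by positivity) hμ
    _ ≤ (M : ℝ)⁻¹ - (K : ℝ)⁻¹ := sum_Ioc_inv_sq_le_sub hM hK
    _ ≤ (M : ℝ)⁻¹ := sub_le_self _ (by positivity)

open ArithmeticFunction ArithmeticFunction.Moebius in
/-- The number of squarefree integers up to `Y` is `(6 / π ^ 2) Y + O(√Y)`. -/
theorem abs_squarefreeCount_sub_le {Y : ℝ} (hY : 0 ≤ Y) :
    |(squarefreeCount ⌊Y⌋₊ : ℝ) - 6 / Real.pi ^ 2 * Y| ≤ 3 * √Y := by
  rcases lt_or_ge Y 1 with h1 | h1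
  · rw [Nat.floor_eq_zero.2 h1]
    have hc : 6 / Real.pi ^ 2 ≤ 1 := by
      rw [div_le_one (by positivity)]
      nlinarith [Real.pi_gt_three]
    have hs : Y ≤ √Y := Real.le_sqrt_of_sq_le (by nlinarith)
    have hc0 : 0 ≤ 6 / Real.pi ^ 2 := by positivity
    simp only [squarefreeCount, Finset.Ioc_self, Finset.sum_empty, Int.cast_zero, zero_sub, abs_neg]
    rw [abs_of_nonneg (by positivity)]
    nlinarith [Real.sqrt_nonneg Y]
  set M := ⌊√Y⌋₊
  have hsq : √Y ^ 2 = Y := Real.sq_sqrt hY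
  have hs1 : 1 ≤ √Y := Real.one_le_sqrt.2 h1
  have hM1 : 1 ≤ M := (Nat.one_le_floor_iff _).2 hs1
  have hMle : (M : ℝ) ≤ √Y := Nat.floor_le (Real.sqrt_nonneg Y)
  have hMlt : √Y < M + 1 := Nat.lt_floor_add_one _
  have hN : ⌊Y⌋₊ < (M + 1) ^ 2 := by
    rw [Nat.floor_lt hY]
    push_cast
    nlinarith
  have hM1' : (1 : ℝ) ≤ M := by exact_mod_cast hM1
  have hmain : |∑ d ∈ Finset.Ioc 0 M, ((μ d : ℝ) * ((⌊Y⌋₊ / d ^ 2 : ℕ) : ℝ) -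
      (μ d : ℝ) / (d : ℝ) ^ 2 * Y)| ≤ M := by
    refine (Finset.abs_sum_le_sum_abs _ _).trans ?_
    refine (Finset.sum_le_card_nsmul _ _ 1 fun d hd => ?_).trans (by simp)
    have hμ : |(μ d : ℝ)| ≤ 1 := by exact_mod_cast abs_moebius_le_one
    have hfl : ⌊Y⌋₊ / d ^ 2 = ⌊Y / (d : ℝ) ^ 2⌋₊ := by
      rw [← Nat.floor_div_natCast]
      push_cast
      rfl
    have hnn : 0 ≤ Y / (d : ℝ) ^ 2 := by positivity
    have e : (μ d : ℝ) * ((⌊Y⌋₊ / d ^ 2 : ℕ) : ℝ) - (μ d : ℝ) / (d : ℝ) ^ 2 * Y =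
        (μ d : ℝ) * ((⌊Y / (d : ℝ) ^ 2⌋₊ : ℝ) - Y / (d : ℝ) ^ 2) := by
      rw [hfl]
      ring
    rw [e, abs_mul]
    refine mul_le_one₀ hμ (abs_nonneg _) ?_
    rw [abs_le]
    constructor <;> linarith [Nat.floor_le hnn, Nat.lt_floor_add_one (Y / (d : ℝ) ^ 2)]
  have htail := abs_sum_moebius_div_sq_sub_le (M := M) (by omega)
  rw [squarefreeCount_eq_sum_moebius hN]
  rw [Finset.sum_sub_distrib, ← Finset.sum_mul] at hmain
  simp only [Int.cast_sum, Int.cast_mul, Int.cast_natCast]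
  have hinv : (M : ℝ)⁻¹ * Y ≤ 2 * √Y := by
    rw [inv_mul_le_iff₀ (by linarith)]
    nlinarith
  set S := ∑ d ∈ Finset.Ioc 0 M, (μ d : ℝ) / (d : ℝ) ^ 2
  have hb : |S * Y - 6 / Real.pi ^ 2 * Y| ≤ 2 * √Y := by
    rw [← sub_mul, abs_mul, abs_of_nonneg hY]
    exact (mul_le_mul_of_nonneg_right htail hY).trans hinv
  calc _ ≤ _ := abs_sub_le _ (S * Y) _
    _ ≤ 3 * √Y := by linarith

theorem squarefree_two_mul {k : ℕ} (hk : k % 2 = 1) : Squarefree (2 * k) ↔ Squarefree k := by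
  rw [Nat.squarefree_mul ((Nat.coprime_two_left).2 (Nat.odd_iff.2 hk))]
  simp [Nat.prime_two.prime.squarefree]

theorem not_squarefree_four_mul (k : ℕ) : ¬ Squarefree (4 * k) := fun h => by
  simpa using h 2 ⟨k, by ring⟩

theorem isFundamentalDiscriminant_iff (f : ℤ) : IsFundamentalDiscriminant f ↔
    (f % 4 = 1 ∧ Squarefree f.natAbs) ∨
      (f % 4 = 0 ∧ Squarefree (f.natAbs / 4) ∧ (f / 4 % 4 = 2 ∨ f / 4 % 4 = 3)) := by
  rw [IsFundamentalDiscriminant, Int.squarefree_natAbs]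
  refine or_congr_right ⟨?_, ?_⟩
  · rintro ⟨m, rfl, hm, h⟩
    have e : (4 * m).natAbs / 4 = m.natAbs := by omega
    rw [e, Int.squarefree_natAbs]
    exact ⟨by omega, hm, by omega⟩
  · rintro ⟨h0, hm, h⟩
    have e : f.natAbs / 4 = (f / 4).natAbs := by omega
    rw [e, Int.squarefree_natAbs] at hm
    exact ⟨f / 4, by omega, hm, h⟩

open Classical in
theorem indicator_isFundamentalDiscriminant_add_neg {n : ℕ} (hn : 0 < n) :
    (if IsFundamentalDiscriminant n then (1 : ℤ) else 0) +
      (if IsFundamentalDiscriminant (-n) then 1 else 0) =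
    (if Squarefree n then 1 else 0) - (if 2 ∣ n then (if Squarefree (n / 2) then 1 else 0) else 0) +
      2 * (if 4 ∣ n then (if Squarefree (n / 4) then 1 else 0) else 0) := by
  simp only [isFundamentalDiscriminant_iff, Int.natAbs_neg, Int.natAbs_natCast]
  rcases Nat.even_or_odd' n with ⟨m, rfl | rfl⟩
  · rcases Nat.even_or_odd' m with ⟨k, rfl | rfl⟩
    · have e : 2 * (2 * k) = 4 * k := by ring
      have e2 : 4 * k / 2 = 2 * k := by omega
      have e4 : 4 * k / 4 = k := by omega
      rw [e, e2, e4]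
      have hns := not_squarefree_four_mul k
      have hd2 : 2 ∣ 4 * k := ⟨2 * k, by ring⟩
      have hd4 : 4 ∣ 4 * k := ⟨k, rfl⟩
      have r1 : ((4 * k : ℕ) : ℤ) % 4 = 0 := by omega
      have r2 : (-((4 * k : ℕ) : ℤ)) % 4 = 0 := by omega
      have q1 : ((4 * k : ℕ) : ℤ) / 4 = k := by omega
      have q2 : (-((4 * k : ℕ) : ℤ)) / 4 = -k := by omega
      simp only [r1, r2, q1, q2, hns, hd2, hd4, if_true, if_false]
      have h4 : Squarefree k → k % 4 ≠ 0 := fun h hk => by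
        obtain ⟨i, rfl⟩ : 4 ∣ k := by omega
        exact not_squarefree_four_mul i h
      have h2 : Squarefree (2 * k) ↔ k % 2 = 1 ∧ Squarefree k := by
        rcases Nat.even_or_odd' k with ⟨j, rfl | rfl⟩
        · have : ¬ Squarefree (2 * (2 * j)) := by
            rw [show 2 * (2 * j) = 4 * j by ring]
            exact not_squarefree_four_mul j
          simp [this]
        · simp [squarefree_two_mul]
      by_cases hsf : Squarefree k
      · have := h4 hsf
        simp only [h2, hsf, and_true, true_and, and_false, false_or, if_true]
        split_ifs <;> omega
      · simp [h2, hsf]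
    · have e2 : 2 * (2 * k + 1) / 2 = 2 * k + 1 := by omega
      have hd2 : 2 ∣ 2 * (2 * k + 1) := ⟨_, rfl⟩
      have hd4 : ¬ 4 ∣ 2 * (2 * k + 1) := by omega
      have h2 : Squarefree (2 * (2 * k + 1)) ↔ Squarefree (2 * k + 1) :=
        squarefree_two_mul (by omega)
      simp only [e2, h2, hd2, hd4, if_true, if_false]
      split_ifs <;> omega
  · have hd2 : ¬ 2 ∣ 2 * m + 1 := by omega
    have hd4 : ¬ 4 ∣ 2 * m + 1 := by omega
    simp only [hd2, hd4, if_false]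
    by_cases hsf : Squarefree (2 * m + 1)
    · simp only [hsf, and_true, if_true]
      split_ifs <;> omega
    · simp only [hsf, and_false, false_or, if_false]
      split_ifs <;> omega

open Classical in
theorem ncard_isFundamentalDiscriminant (N : ℕ) :
    ({f : ℤ | IsFundamentalDiscriminant f ∧ 0 < |f| ∧ |f| ≤ N}.ncard : ℤ) =
      squarefreeCount N - squarefreeCount (N / 2) + 2 * squarefreeCount (N / 4) := by
  let P : Finset ℕ := (Finset.Ioc 0 N).filter fun n => IsFundamentalDiscriminant n
  let R : Finset ℕ := (Finset.Ioc 0 N).filter fun n => IsFundamentalDiscriminant (-n)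
  have hset : {f : ℤ | IsFundamentalDiscriminant f ∧ 0 < |f| ∧ |f| ≤ N} =
      ((P.image (fun n : ℕ => (n : ℤ)) ∪ R.image (fun n : ℕ => -(n : ℤ)) : Finset ℤ) : Set ℤ) := by
    ext f
    simp only [Int.abs_eq_natAbs, P, R, Set.mem_ofPred_eq, Finset.coe_union, Finset.coe_image, Set.mem_union,
      Set.mem_image, Finset.mem_coe, Finset.mem_filter, Finset.mem_Ioc]
    constructor
    · rintro ⟨hf, h0, hN⟩
      rcases Int.natAbs_eq f with h | h
      · exact Or.inl ⟨f.natAbs, ⟨by omega, h ▸ hf⟩, h.symm⟩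
      · exact Or.inr ⟨f.natAbs, ⟨by omega, h ▸ hf⟩, h.symm⟩
    · rintro (⟨n, ⟨hn, hf⟩, rfl⟩ | ⟨n, ⟨hn, hf⟩, rfl⟩)
      · exact ⟨hf, by omega, by omega⟩
      · exact ⟨hf, by omega, by omega⟩
  have hdisj : Disjoint (P.image fun n : ℕ => (n : ℤ)) (R.image fun n : ℕ => -(n : ℤ)) := by
    rw [Finset.disjoint_left]
    intro f hP hR
    simp only [P, R, Finset.mem_image, Finset.mem_filter, Finset.mem_Ioc] at hP hR
    obtain ⟨a, ha, rfl⟩ := hP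
    obtain ⟨b, hb, h⟩ := hR
    omega
  rw [hset, Set.ncard_coe_finset, Finset.card_union_of_disjoint hdisj,
    Finset.card_image_of_injective _ Nat.cast_injective,
    Finset.card_image_of_injective R fun a b (h : -(a : ℤ) = -b) => by omega]
  simp only [P, R, Finset.card_filter, Nat.cast_add, Nat.cast_sum, Nat.cast_ite, Nat.cast_one,
    Nat.cast_zero]
  rw [← Finset.sum_add_distrib, Finset.sum_congr rfl fun n hn =>
    indicator_isFundamentalDiscriminant_add_neg (Finset.mem_Ioc.1 hn).1]
  rw [Finset.sum_add_distrib, Finset.sum_sub_distrib, ← Finset.mul_sum,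
    sum_Ioc_ite_dvd (fun m => if Squarefree m then 1 else 0) two_pos,
    sum_Ioc_ite_dvd (fun m => if Squarefree m then 1 else 0) four_pos]
  rfl

/-- The number of fundamental discriminants `f` with `0 < |f| ≤ X`
is `(6/π²)·X + O(X^{1/2})`, with a universal constant. -/
theorem count_fundamental_discriminants :
    ∃ C : ℝ, 0 < C ∧ ∀ X : ℝ, 1 ≤ X →
      |(({f : ℤ | IsFundamentalDiscriminant f ∧ 0 < |f| ∧ |(f : ℝ)| ≤ X}.ncard : ℝ))
          - (6 / Real.pi ^ 2) * X| ≤ C * X ^ ((1 : ℝ) / 2) := by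
  refine ⟨12, by norm_num, fun X hX => ?_⟩
  have hX0 : 0 ≤ X := by linarith
  have hset : {f : ℤ | IsFundamentalDiscriminant f ∧ 0 < |f| ∧ |(f : ℝ)| ≤ X} =
      {f : ℤ | IsFundamentalDiscriminant f ∧ 0 < |f| ∧ |f| ≤ (⌊X⌋₊ : ℤ)} := by
    ext f
    simp only [Set.mem_ofPred_eq]
    rw [Int.natCast_floor_eq_floor hX0, Int.le_floor, Int.cast_abs]
  have hcard : ({f : ℤ | IsFundamentalDiscriminant f ∧ 0 < |f| ∧ |(f : ℝ)| ≤ X}.ncard : ℝ) =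
      squarefreeCount ⌊X⌋₊ - squarefreeCount ⌊X / 2⌋₊ + 2 * squarefreeCount ⌊X / 4⌋₊ := by
    have h2 : ⌊X / 2⌋₊ = ⌊X⌋₊ / 2 := by exact_mod_cast Nat.floor_div_natCast X 2
    have h4 : ⌊X / 4⌋₊ = ⌊X⌋₊ / 4 := by exact_mod_cast Nat.floor_div_natCast X 4
    rw [hset, h2, h4]
    exact_mod_cast ncard_isFundamentalDiscriminant ⌊X⌋₊
  have b1 := abs_le.1 (abs_squarefreeCount_sub_le hX0)
  have b2 := abs_le.1 (abs_squarefreeCount_sub_le (Y := X / 2) (by positivity))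
  have b4 := abs_le.1 (abs_squarefreeCount_sub_le (Y := X / 4) (by positivity))
  have s2 : √(X / 2) ≤ √X := Real.sqrt_le_sqrt (by linarith)
  have s4 : √(X / 4) ≤ √X := Real.sqrt_le_sqrt (by linarith)
  rw [hcard, ← Real.sqrt_eq_rpow, abs_le]
  constructor <;> linarith
end

section
/- For every ε > 0 there exists a constant C(ε) > 0 such that for every positive integer D, every odd prime p, and every real X ≥ 1: |∑_f (f/p)| ≤ C(ε)·τ(D)·(X^{1−ε²} + X^{1/2}·p^{1/8 + ε/2}), where the sum runs over all odd fundamental discriminants f with gcd(f, D) = 1 and X ≤ |f| < 2X, (f/p) denotes the Legendre symbol of f modulo p, and τ(D) denotes the number of positive divisors of D. -/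
open Polynomial in
/-- The linear operators `T_k` for which the `k`-th derivative of `f ^ e * r` equals
`f ^ (e - k) * T_k r`. -/
noncomputable def stepanovOp {F : Type*} [Field F] (f : F[X]) (e : ℕ) : ℕ → (F[X] →ₗ[F] F[X])
  | 0 => LinearMap.id
  | k + 1 => (((e - k : ℕ) : F) • LinearMap.mulLeft F (derivative f) +
      LinearMap.mulLeft F f ∘ₗ derivative) ∘ₗ stepanovOp f e k

open Polynomial in
lemma stepanovOp_succ_apply {F : Type*} [Field F] (f : F[X]) (e k : ℕ) (r : F[X]) :
    stepanovOp f e (k + 1) r = ((e - k : ℕ) : F) • (derivative f * stepanovOp f e k r) +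
      f * derivative (stepanovOp f e k r) := by
  simp [stepanovOp]

open Polynomial in
lemma iterate_derivative_pow_mul_eq_stepanovOp {F : Type*} [Field F] (f : F[X]) (e k : ℕ)
    (hk : k ≤ e) (r : F[X]) :
    derivative^[k] (f ^ e * r) = f ^ (e - k) * stepanovOp f e k r := by
  induction k with
  | zero => simp [stepanovOp]
  | succ k ih =>
    rw [Function.iterate_succ_apply', ih (by omega), stepanovOp_succ_apply]
    obtain ⟨d, hd⟩ : ∃ d, e - k = d + 1 := ⟨e - k - 1, by omega⟩
    have h2 : e - (k + 1) = d := by omega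
    rw [h2, hd, derivative_mul, derivative_pow_succ, smul_eq_C_mul]
    push_cast
    simp only [map_add, map_natCast, map_one]
    ring

open Polynomial in
lemma natDegree_stepanovOp_le {F : Type*} [Field F] (f : F[X]) (e k : ℕ) (r : F[X]) :
    (stepanovOp f e k r).natDegree ≤ r.natDegree + k * f.natDegree := by
  induction k with
  | zero => simp [stepanovOp]
  | succ k ih =>
    rw [stepanovOp_succ_apply]
    refine (natDegree_add_le _ _).trans (max_le ?_ ?_)
    · refine (natDegree_smul_le _ _).trans (natDegree_mul_le.trans ?_)
      have := natDegree_derivative_le f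
      rw [add_mul, one_mul]
      omega
    · refine natDegree_mul_le.trans ?_
      have := natDegree_derivative_le (stepanovOp f e k r)
      rw [add_mul, one_mul]
      omega

open Polynomial in
lemma iterate_derivative_mul_X_pow_mul_char {p : ℕ} [Fact p.Prime] (g : (ZMod p)[X]) (j k : ℕ) :
    derivative^[k] (g * X ^ (j * p)) = derivative^[k] g * X ^ (j * p) := by
  induction k with
  | zero => simp
  | succ k ih =>
    rw [Function.iterate_succ_apply', ih, Function.iterate_succ_apply', derivative_mul,
      derivative_X_pow]
    simp

open Polynomial in
/-- The term of index `(j, b)` in Stepanov's auxiliary polynomial. -/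
noncomputable def stepanovTerm {p : ℕ} (f : (ZMod p)[X]) (l j : ℕ) (b : Bool)
    (r : (ZMod p)[X]) : (ZMod p)[X] :=
  f ^ (l + if b then (p - 1) / 2 else 0) * r * X ^ (j * p)

open Polynomial in
lemma sum_stepanovTerm_ne_zero {p : ℕ} [Fact p.Prime] {f : (ZMod p)[X]} {n J l : ℕ}
    (hp : f.natDegree + 2 * n = p) (hodd : Odd f.natDegree)
    (v : Fin J × Bool → degreeLT (ZMod p) n) (hv : v ≠ 0) :
    ∑ i : Fin J × Bool, stepanovTerm f l i.1 i.2 (v i) ≠ 0 := by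
  obtain ⟨k, hk⟩ := hodd
  have hf : f ≠ 0 := by rintro rfl; simp at hk
  obtain ⟨i₀, hi₀⟩ := Function.ne_iff.1 hv
  have hp2 : (p - 1) / 2 = k + n := by omega
  have hdeg : ∀ i : Fin J × Bool, (v i : (ZMod p)[X]) ≠ 0 →
      (stepanovTerm f l i.1 i.2 (v i)).natDegree =
        l * f.natDegree + ((v i : (ZMod p)[X]).natDegree + (if i.2 then n else 0) +
          p * (i.1 + if i.2 then k else 0)) := by
    intro i hi
    rw [stepanovTerm, natDegree_mul (mul_ne_zero (pow_ne_zero _ hf) hi) (pow_ne_zero _ X_ne_zero),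
      natDegree_mul (pow_ne_zero _ hf) hi, natDegree_pow, natDegree_X_pow, hp2]
    rcases i with ⟨j, b⟩
    cases b
    · simp; ring
    · simp only [if_true]
      have : (k + n) * f.natDegree = n + p * k := by
        calc (k + n) * f.natDegree = (k + n) * (2 * k + 1) := by rw [hk]
          _ = n + (2 * k + 1 + 2 * n) * k := by ring
          _ = n + p * k := by
            have : 2 * k + 1 + 2 * n = p := by omega
            simp only [this]
      rw [add_mul, this]; ring
  have hlt : ∀ i : Fin J × Bool, (v i : (ZMod p)[X]) ≠ 0 → (v i : (ZMod p)[X]).natDegree < n := by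
    intro i hi
    exact (natDegree_lt_iff_degree_lt hi).2 (mem_degreeLT.1 (v i).2)
  have hne : ∀ i : Fin J × Bool, stepanovTerm f l i.1 i.2 (v i) ≠ 0 ↔ (v i : (ZMod p)[X]) ≠ 0 := by
    intro i
    simp [stepanovTerm, hf, X_ne_zero]
  intro h0
  have hsum := degree_sum_eq_of_disjoint (fun i : Fin J × Bool => stepanovTerm f l i.1 i.2 (v i))
    Finset.univ ?_
  · rw [h0, degree_zero] at hsum
    have := (Finset.sup_eq_bot_iff _ _).1 hsum.symm i₀ (Finset.mem_univ _)
    rw [degree_eq_bot] at this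
    exact (hne i₀).2 (fun h => hi₀ (Subtype.ext h)) this
  · rintro a ⟨-, ha⟩ b ⟨-, hb⟩ hab heq
    have ha' := (hne a).1 ha
    have hb' := (hne b).1 hb
    have heq' := natDegree_eq_of_degree_eq heq
    simp only at heq'
    rw [hdeg a ha', hdeg b hb', add_right_inj] at heq'
    have h1 := hlt a ha'
    have h2 := hlt b hb'
    have hp0 : 0 < p := (Fact.out : p.Prime).pos
    have hmod := congrArg (· % p) heq'
    have hdiv := congrArg (· / p) heq'
    simp only [Nat.add_mul_mod_self_left] at hmod
    simp only [Nat.add_mul_div_left _ _ hp0] at hdiv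
    have hA : (v a : (ZMod p)[X]).natDegree + (if a.2 then n else 0) < p := by split_ifs <;> omega
    have hB : (v b : (ZMod p)[X]).natDegree + (if b.2 then n else 0) < p := by split_ifs <;> omega
    rw [Nat.mod_eq_of_lt hA, Nat.mod_eq_of_lt hB] at hmod
    rw [Nat.div_eq_of_lt hA, Nat.div_eq_of_lt hB] at hdiv
    rcases a with ⟨⟨a1, ha1⟩, a2⟩
    rcases b with ⟨⟨b1, hb1⟩, b2⟩
    apply hab
    cases a2 <;> cases b2 <;> simp at hmod hdiv h1 h2 ⊢ <;> omega

open Polynomial in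
/-- Existence of a nonzero coefficient vector for which the first `l` derivatives of the
auxiliary polynomial vanish where `f ^ ((p - 1) / 2) = a`. -/
lemma exists_stepanov_coeffs {p : ℕ} [Fact p.Prime] (f : (ZMod p)[X]) (a : ZMod p) {n J l : ℕ}
    (hn : 0 < n) (hl : l * (n + l * f.natDegree + J) < 2 * J * n) :
    ∃ v : Fin J × Bool → degreeLT (ZMod p) n, v ≠ 0 ∧ ∀ k < l,
      ∑ i : Fin J × Bool, (if i.2 then a else 1) •
        (stepanovOp f (l + if i.2 then (p - 1) / 2 else 0) k (v i) * X ^ (i.1 : ℕ)) = 0 := by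
  classical
  set M := n + l * f.natDegree + J with hM
  let P : (Fin J × Bool → degreeLT (ZMod p) n) → ℕ → (ZMod p)[X] := fun v k =>
    ∑ i : Fin J × Bool, (if i.2 then a else 1) •
        (stepanovOp f (l + if i.2 then (p - 1) / 2 else 0) k (v i) * X ^ (i.1 : ℕ))
  let Φ : (Fin J × Bool → degreeLT (ZMod p) n) →ₗ[ZMod p] (Fin l → Fin M → ZMod p) :=
    { toFun := fun v k i => (P v k).coeff i
      map_add' := by
        intro v w
        ext k i
        simp only [P, Pi.add_apply, Submodule.coe_add, map_add, add_mul, smul_add,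
          Finset.sum_add_distrib, coeff_add]
      map_smul' := by
        intro c v
        ext k i
        simp only [P, Pi.smul_apply, Submodule.coe_smul, map_smul, smul_mul_assoc,
          RingHom.id_apply, ← coeff_smul, Finset.smul_sum]
        congr 1
        refine Finset.sum_congr rfl fun x _ => ?_
        rw [smul_comm] }
  have hker : Φ.ker ≠ ⊥ := by
    have : Module.Finite (ZMod p) (degreeLT (ZMod p) n) :=
      Module.Finite.equiv (degreeLTEquiv (ZMod p) n).symm
    apply LinearMap.ker_ne_bot_of_finrank_lt
    have h1 : Module.finrank (ZMod p) (degreeLT (ZMod p) n) = n := by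
      rw [LinearEquiv.finrank_eq (degreeLTEquiv (ZMod p) n)]; simp
    simp only [Module.finrank_pi_fintype, h1]
    simp
    nlinarith
  obtain ⟨v, hv, hv0⟩ := (Submodule.ne_bot_iff _).1 hker
  refine ⟨v, hv0, fun k hk => ?_⟩
  have hdeg : (P v k).natDegree < M := by
    have : (P v k).natDegree ≤ M - 1 := by
      refine natDegree_sum_le_of_forall_le _ _ fun i _ => ?_
      refine (natDegree_smul_le _ _).trans (natDegree_mul_le.trans ?_)
      rw [natDegree_X_pow]
      have h1 := natDegree_stepanovOp_le f (l + if i.2 then (p - 1) / 2 else 0) k (v i)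
      have h2 : (v i : (ZMod p)[X]).natDegree ≤ n - 1 := by
        have := mem_degreeLT.1 (v i).2
        by_cases h : (v i : (ZMod p)[X]) = 0
        · rw [h]; simp
        · have := (natDegree_lt_iff_degree_lt h).2 this
          omega
      have h3 : k * f.natDegree ≤ l * f.natDegree := Nat.mul_le_mul_right _ hk.le
      have h4 := i.1.2
      omega
    omega
  have hz : Φ v = 0 := hv
  change P v k = 0
  ext i
  by_cases hi : i < M
  · exact congrFun (congrFun hz ⟨k, hk⟩) ⟨i, hi⟩
  · rw [coeff_eq_zero_of_natDegree_lt (by omega), coeff_zero]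

open Polynomial in
/-- Stepanov's bound for the number of points where `f ^ ((p - 1) / 2) = a`. -/
lemma card_pow_eq_mul_le {p : ℕ} [Fact p.Prime] (f : (ZMod p)[X]) (a : ZMod p) {n J l : ℕ}
    (hn : 0 < n) (hl : l * (n + l * f.natDegree + J) < 2 * J * n) (hlp : l < p)
    (hp : f.natDegree + 2 * n = p) (hodd : Odd f.natDegree) :
    (Finset.univ.filter fun x : ZMod p => f.eval x ^ ((p - 1) / 2) = a).card * l ≤
      (l + (p - 1) / 2) * f.natDegree + n + (J - 1) * p := by
  classical
  obtain ⟨v, hv, hk⟩ := exists_stepanov_coeffs f a hn hl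
  have hR := sum_stepanovTerm_ne_zero (l := l) hp hodd v hv
  set R := ∑ i : Fin J × Bool, stepanovTerm f l i.1 i.2 (v i) with hRdef
  have hdegR : R.natDegree ≤ (l + (p - 1) / 2) * f.natDegree + n + (J - 1) * p := by
    refine natDegree_sum_le_of_forall_le _ _ fun i _ => ?_
    rw [stepanovTerm]
    refine natDegree_mul_le.trans (add_le_add (natDegree_mul_le.trans (add_le_add ?_ ?_)) ?_)
    · refine natDegree_pow_le.trans (Nat.mul_le_mul_right _ ?_)
      split_ifs <;> omega
    · by_cases h : (v i : (ZMod p)[X]) = 0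
      · rw [h]; simp
      · exact ((natDegree_lt_iff_degree_lt h).2 (mem_degreeLT.1 (v i).2)).le
    · rw [natDegree_X_pow]
      have := i.1.2
      exact Nat.mul_le_mul_right _ (by omega)
  rcases Nat.eq_zero_or_pos l with rfl | hl0
  · simp
  set S := Finset.univ.filter fun x : ZMod p => f.eval x ^ ((p - 1) / 2) = a with hS
  have hdvd : ∏ x ∈ S, (X - C x) ^ l ∣ R := by
    refine Finset.prod_dvd_of_coprime ?_ ?_
    · intro x _ y _ hxy
      exact IsCoprime.pow (pairwise_coprime_X_sub_C (s := fun x : ZMod p => x)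
        Function.injective_id hxy)
    · intro x hx
      rw [← le_rootMultiplicity_iff hR]
      have := lt_rootMultiplicity_of_isRoot_iterate_derivative_of_mem_nonZeroDivisors
        (p := R) (t := x) (n := l - 1) hR ?_ ?_
      · omega
      · intro k hkl
        have hkl' : k < l := by omega
        have hx' : f.eval x ^ ((p - 1) / 2) = a := by simpa [hS] using hx
        have h0 := congrArg (eval x) (hk k hkl')
        rw [IsRoot, hRdef, iterate_derivative_sum, eval_finsetSum]
        rw [eval_finsetSum, eval_zero] at h0
        rw [← mul_zero (f.eval x ^ (l - k)), ← h0, Finset.mul_sum]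
        refine Finset.sum_congr rfl fun i _ => ?_
        rw [stepanovTerm, iterate_derivative_mul_X_pow_mul_char,
          iterate_derivative_pow_mul_eq_stepanovOp _ _ _ (by omega)]
        simp only [eval_mul, eval_pow, eval_X, eval_smul, smul_eq_mul]
        rw [mul_comm (i.1 : ℕ) p, pow_mul, ZMod.pow_card]
        have : l + (if i.2 then (p - 1) / 2 else 0) - k =
          (l - k) + (if i.2 then (p - 1) / 2 else 0) := by omega
        rw [this, pow_add]
        split_ifs
        · rw [hx']; ring
        · rw [pow_zero]; ring
      · rw [mem_nonZeroDivisors_iff_ne_zero, Ne, ZMod.natCast_eq_zero_iff,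
          (Fact.out : p.Prime).dvd_factorial]
        omega
  have h1 := natDegree_le_of_dvd hdvd hR
  rw [natDegree_prod _ _ (fun x _ => pow_ne_zero _ (X_sub_C_ne_zero x))] at h1
  simp only [natDegree_pow, natDegree_X_sub_C, mul_one, Finset.sum_const, smul_eq_mul] at h1
  exact h1.trans hdegR

open Polynomial in
lemma card_pow_eq_le {p : ℕ} [Fact p.Prime] (f : (ZMod p)[X]) (a : ZMod p) (hp2 : p ≠ 2)
    (hodd : Odd f.natDegree) (hbig : 8 * f.natDegree + 8 ≤ Nat.sqrt p) :
    ((Finset.univ.filter fun x : ZMod p => f.eval x ^ ((p - 1) / 2) = a).card : ℝ) ≤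
      p / 2 + (18 * f.natDegree + 17) * √p := by
  set m := f.natDegree with hm
  set h := Nat.sqrt p with hh
  have h1 : h * h ≤ p := Nat.sqrt_le p
  have h2 : p < (h + 1) * (h + 1) := Nat.lt_succ_sqrt p
  have hpodd : Odd p := (Fact.out : p.Prime).odd_of_ne_two hp2
  obtain ⟨k, hk⟩ := hodd
  obtain ⟨q, hq⟩ := hpodd
  have hmp : m < h * h := by nlinarith
  obtain ⟨n, hn⟩ : ∃ n, m + 2 * n = p := ⟨q - k, by omega⟩
  have hn0 : 0 < n := by omega
  have key := card_pow_eq_mul_le (l := 2 * h) (J := h + (8 * m + 8)) f a hn0 ?_ ?_ hn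
    (by rw [← hm]; exact ⟨k, hk⟩)
  · set S := (Finset.univ.filter fun x : ZMod p => f.eval x ^ ((p - 1) / 2) = a).card with hS
    have hJ : h + (8 * m + 8) - 1 = h + (8 * m + 7) := by omega
    rw [← hm, hJ] at key
    have hq2 : (p - 1) / 2 = q := by omega
    rw [hq2] at key
    have keyR : (S : ℝ) * (2 * h) ≤ (2 * h + q) * m + n + (h + (8 * m + 7)) * p := by
      exact_mod_cast key
    have hqR : (p : ℝ) = 2 * q + 1 := by exact_mod_cast hq
    have hnR : (m : ℝ) + 2 * n = p := by exact_mod_cast hn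
    have h1R : (h : ℝ) * h ≤ p := by exact_mod_cast h1
    have h2R : (p : ℝ) < (h + 1) * (h + 1) := by exact_mod_cast h2
    have hbR : 8 * (m : ℝ) + 8 ≤ h := by exact_mod_cast hbig
    have hm0 : (0 : ℝ) ≤ m := Nat.cast_nonneg _
    have hs : (h : ℝ) ≤ √p := Real.le_sqrt_of_sq_le (by rw [sq]; exact h1R)
    have hp4 : (p : ℝ) ≤ 4 * (h * h) := by nlinarith
    have hh0 : (0 : ℝ) < h := by linarith
    have : (S : ℝ) ≤ p / 2 + (18 * m + 17) * h := by
      by_contra hcon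
      push Not at hcon
      have := mul_lt_mul_of_pos_right hcon (by positivity : (0 : ℝ) < 2 * h)
      have h3 : (m : ℝ) * p ≤ m * (4 * (h * h)) := mul_le_mul_of_nonneg_left hp4 hm0
      nlinarith
    refine this.trans ?_
    gcongr
  · rw [← hm]
    zify at *
    nlinarith [mul_nonneg (sub_nonneg.2 hbig) (Nat.cast_nonneg (α := ℤ) m),
      mul_nonneg (mul_nonneg (sub_nonneg.2 hbig) (Nat.cast_nonneg (α := ℤ) m))
        (Nat.cast_nonneg (α := ℤ) h),
      mul_nonneg (sub_nonneg.2 hbig) (Nat.cast_nonneg (α := ℤ) h)]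
  · nlinarith

open Polynomial in
/-- Weil's bound, with an unspecified constant, for quadratic character sums of polynomials of
odd degree. -/
theorem exists_sum_quadraticChar_eval_le (m : ℕ) (hm : Odd m) :
    ∃ C : ℝ, 0 < C ∧ ∀ (p : ℕ) [Fact p.Prime], p ≠ 2 → ∀ f : (ZMod p)[X], f.natDegree = m →
      |∑ x, (quadraticChar (ZMod p) (f.eval x) : ℝ)| ≤ C * √p := by
  refine ⟨2 * (18 * m + 17) + m, by positivity, fun p _ hp2 f hf => ?_⟩
  classical
  have hf0 : f ≠ 0 := by rintro rfl; simp [← hf] at hm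
  let N : ℤ → ℕ := fun s =>
    (Finset.univ.filter fun x : ZMod p => quadraticChar (ZMod p) (f.eval x) = s).card
  have hsum : ∑ x, (quadraticChar (ZMod p) (f.eval x) : ℝ) = N 1 - N (-1) := by
    simp only [N, Finset.card_filter, Nat.cast_sum, ← Finset.sum_sub_distrib]
    refine Finset.sum_congr rfl fun x _ => ?_
    by_cases h0 : f.eval x = 0
    · simp [h0]
    · rcases quadraticChar_dichotomy h0 with h | h <;> simp [h]
  have hN : N 1 + N (-1) + N 0 = p := by
    have : ∑ x : ZMod p, 1 = p := by simp
    rw [← this]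
    simp only [N, Finset.card_filter, ← Finset.sum_add_distrib]
    refine Finset.sum_congr rfl fun x _ => ?_
    by_cases h0 : f.eval x = 0
    · simp [h0]
    · rcases quadraticChar_dichotomy h0 with h | h <;> simp [h]
  have hN0 : N 0 ≤ m := by
    rw [← hf]
    refine le_trans (Finset.card_le_card ?_) (f.roots.toFinset_card_le.trans (card_roots' f))
    intro x hx
    have hx' : quadraticChar (ZMod p) (f.eval x) = 0 := by simpa using hx
    rw [quadraticChar_eq_zero_iff] at hx'
    simp [hf0, hx']
  have hNR : (N 1 : ℝ) + N (-1) + N 0 = p := by exact_mod_cast hN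
  have hN0R : (N 0 : ℝ) ≤ m := by exact_mod_cast hN0
  have hp1 : (1 : ℝ) ≤ √p := by
    rw [Real.one_le_sqrt]; exact_mod_cast (Fact.out : p.Prime).one_lt.le
  have hss : √p * √p = p := Real.mul_self_sqrt (Nat.cast_nonneg p)
  have hm0 : (0 : ℝ) ≤ m := Nat.cast_nonneg _
  have hpos : ∀ s : ℤ, (0 : ℝ) ≤ N s := fun s => Nat.cast_nonneg _
  rw [hsum, abs_le]
  by_cases hbig : 8 * m + 8 ≤ Nat.sqrt p
  · have hle : ∀ s : ℤ, (N s : ℝ) ≤ p / 2 + (18 * m + 17) * √p := by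
      intro s
      rw [← hf] at hbig hm
      have := card_pow_eq_le f (s : ZMod p) hp2 hm hbig
      rw [← hf]
      refine le_trans ?_ this
      rw [Nat.cast_le]
      refine Finset.card_le_card fun x hx => ?_
      have hx' : quadraticChar (ZMod p) (f.eval x) = s := by simpa using hx
      have h2 : ringChar (ZMod p) ≠ 2 := by rwa [ZMod.ringChar_zmod_n]
      have := quadraticChar_eq_pow_of_char_ne_two' h2 (f.eval x)
      rw [hx', ZMod.card] at this
      have hq : (p - 1) / 2 = p / 2 := by
        obtain ⟨q, hq⟩ := (Fact.out : p.Prime).odd_of_ne_two hp2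
        omega
      simp [hq, this]
    have a1 := hle 1
    have a2 := hle (-1)
    constructor <;> nlinarith [hpos 0]
  · have hs : Nat.sqrt p + 1 ≤ 8 * m + 8 := by omega
    have hsR : √(p : ℝ) ≤ 8 * m + 8 := by
      refine (Real.sqrt_le_sqrt (y := ((8 * m + 8 : ℕ) : ℝ) ^ 2) ?_).trans ?_
      · have := Nat.lt_succ_sqrt' p
        have h3 : p ≤ (8 * m + 8) ^ 2 := this.le.trans (Nat.pow_le_pow_left hs 2)
        exact_mod_cast h3
      · rw [Real.sqrt_sq (by positivity)]; push_cast; rfl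
    have : (p : ℝ) ≤ (2 * (18 * m + 17) + m) * √p := by
      have h5 : √(p : ℝ) * √p ≤ (2 * (18 * m + 17) + m) * √p :=
        mul_le_mul_of_nonneg_right (by linarith) (Real.sqrt_nonneg _)
      linarith
    have a0 := hpos 0
    have a1 := hpos 1
    have a2 := hpos (-1)
    constructor <;> linarith

open Polynomial in
lemma sum_prod_quadraticChar_add_eq {p : ℕ} [Fact p.Prime] {ι : Type*} [Fintype ι]
    (hι : Even (Fintype.card ι)) (b : ι → ZMod p) (i₀ : ι) :
    ∑ x, ∏ i, quadraticChar (ZMod p) (x + b i) =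
      ∑ y, quadraticChar (ZMod p) ((∏ i, (1 + C (b i - b i₀) * X)).eval y) - 1 := by
  classical
  rw [← Equiv.sum_comp (Equiv.subRight (b i₀)), ← Equiv.sum_comp (Equiv.inv (ZMod p)),
    ← Finset.add_sum_erase _ _ (Finset.mem_univ (0 : ZMod p)),
    ← Finset.add_sum_erase _ (fun y => quadraticChar (ZMod p) _) (Finset.mem_univ (0 : ZMod p))]
  have h0 : ∏ i, quadraticChar (ZMod p) ((Equiv.subRight (b i₀)) ((Equiv.inv (ZMod p)) 0) + b i)
      = 0 := Finset.prod_eq_zero (Finset.mem_univ i₀) (by simp)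
  rw [h0, eval_prod]
  simp only [eval_add, eval_one, eval_mul, eval_C, eval_X, mul_zero, add_zero, Finset.prod_const_one,
    map_one, zero_add, add_sub_cancel_left]
  refine Finset.sum_congr rfl fun y hy => ?_
  have hy0 : y ≠ 0 := Finset.ne_of_mem_erase hy
  have hterm : ∀ i, quadraticChar (ZMod p)
      ((Equiv.subRight (b i₀)) ((Equiv.inv (ZMod p)) y) + b i) =
      quadraticChar (ZMod p) y⁻¹ * quadraticChar (ZMod p) (1 + (b i - b i₀) * y) := by
    intro i
    rw [← map_mul]
    congr 1
    simp only [Equiv.subRight_apply, Equiv.inv_apply]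
    field_simp
    ring
  rw [Finset.prod_congr rfl fun i _ => hterm i, Finset.prod_mul_distrib, Finset.prod_const,
    Finset.card_univ, eval_prod, map_prod]
  obtain ⟨k, hk⟩ := hι
  rw [hk, ← two_mul, pow_mul, quadraticChar_sq_one (inv_ne_zero hy0), one_pow, one_mul]
  simp

open Polynomial in
lemma natDegree_prod_one_add_C_mul_X {F ι : Type*} [Field F] [DecidableEq F] [Fintype ι]
    (c : ι → F) :
    (∏ i, (1 + C (c i) * X)).natDegree = (Finset.univ.filter fun i => c i ≠ 0).card := by
  have hne : ∀ i, (1 + C (c i) * X : F[X]) ≠ 0 := by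
    intro i h
    have := congrArg (eval 0) h
    simp at this
  rw [natDegree_prod _ _ (fun i _ => hne i), Finset.card_filter]
  refine Finset.sum_congr rfl fun i _ => ?_
  by_cases h : c i = 0
  · simp [h]
  · rw [if_pos h, add_comm, ← C_1]
    exact natDegree_linear h

lemma exists_sum_prod_quadraticChar_le (r : ℕ) :
    ∃ C : ℝ, 0 < C ∧ ∀ (p : ℕ) [Fact p.Prime], p ≠ 2 → ∀ (b : Fin (2 * r) → ZMod p)
      (i₀ : Fin (2 * r)), Odd (Finset.univ.filter fun i => b i = b i₀).card →
      |∑ x, ∏ i, (quadraticChar (ZMod p) (x + b i) : ℝ)| ≤ C * √p := by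
  have H : ∀ m : ℕ, ∃ C : ℝ, 0 < C ∧ (Odd m → ∀ (p : ℕ) [Fact p.Prime], p ≠ 2 →
      ∀ f : Polynomial (ZMod p), f.natDegree = m →
      |∑ x, (quadraticChar (ZMod p) (f.eval x) : ℝ)| ≤ C * √p) := by
    intro m
    by_cases hm : Odd m
    · obtain ⟨C, hC, h⟩ := exists_sum_quadraticChar_eval_le m hm
      exact ⟨C, hC, fun _ => h⟩
    · exact ⟨1, one_pos, fun h => absurd h hm⟩
  choose C hC hb using H
  refine ⟨∑ m ∈ Finset.range (2 * r + 1), C m + 1, add_pos_of_nonneg_of_pos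
    (Finset.sum_nonneg fun m _ => (hC m).le) one_pos, fun p _ hp2 b i₀ hodd => ?_⟩
  have h1 := sum_prod_quadraticChar_add_eq (by simp) b i₀
  have h1R : ∑ x, ∏ i, (quadraticChar (ZMod p) (x + b i) : ℝ) =
      ∑ y, (quadraticChar (ZMod p) ((∏ i, (1 + Polynomial.C (b i - b i₀) * Polynomial.X)).eval y) :
        ℝ) - 1 := by
    exact_mod_cast congrArg (Int.cast : ℤ → ℝ) h1
  have hdeg := natDegree_prod_one_add_C_mul_X (fun i => b i - b i₀)
  simp only [sub_ne_zero] at hdeg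
  have hcard := Finset.card_filter_add_card_filter_not (s := (Finset.univ : Finset (Fin (2 * r))))
    (fun i => b i = b i₀)
  simp only [Finset.card_univ, Fintype.card_fin] at hcard
  set m := (Finset.univ.filter fun i => b i ≠ b i₀).card with hm
  change _ + m = _ at hcard
  have hmodd : Odd m := by
    obtain ⟨k, hk⟩ := hodd
    exact ⟨r - k - 1, by omega⟩
  have h2 := hb m hmodd p hp2 _ hdeg
  have hp1 : (1 : ℝ) ≤ √p := by
    rw [Real.one_le_sqrt]; exact_mod_cast (Fact.out : p.Prime).one_lt.le
  have h3 : C m ≤ ∑ m ∈ Finset.range (2 * r + 1), C m :=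
    Finset.single_le_sum (f := C) (fun m _ => (hC m).le) (Finset.mem_range.2 (by omega))
  rw [h1R]
  refine (abs_sub _ _).trans ?_
  rw [abs_one, add_mul, one_mul]
  exact add_le_add (h2.trans (mul_le_mul_of_nonneg_right h3 (by positivity))) hp1

lemma card_filter_fibers_even_le (r B : ℕ) (hr : 0 < r) :
    (Finset.univ.filter fun t : Fin (2 * r) → Fin B =>
      ∀ i₀, ¬ Odd (Finset.univ.filter fun i => t i = t i₀).card).card ≤ r ^ (2 * r) * B ^ r := by
  classical
  have hsub : (Finset.univ.filter fun t : Fin (2 * r) → Fin B =>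
      ∀ i₀, ¬ Odd (Finset.univ.filter fun i => t i = t i₀).card) ⊆
      (Finset.univ : Finset ((Fin (2 * r) → Fin r) × (Fin r → Fin B))).image
        fun gh => gh.2 ∘ gh.1 := by
    intro t ht
    simp only [Finset.mem_filter, Finset.mem_univ, true_and] at ht
    simp only [Finset.mem_image, Finset.mem_univ, true_and, Prod.exists]
    set I := Finset.univ.image t with hI
    have hcard : 2 * I.card ≤ 2 * r := by
      have : 2 * I.card ≤ (Finset.univ : Finset (Fin (2 * r))).card := by
        refine Finset.mul_card_image_le_card_of_maps_to (f := t)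
          (fun i _ => Finset.mem_image_of_mem _ (Finset.mem_univ i)) 2 ?_
        intro y hy
        obtain ⟨i₀, -, rfl⟩ := Finset.mem_image.1 hy
        have h1 := Nat.not_odd_iff_even.1 (ht i₀)
        have h2 : 0 < (Finset.univ.filter fun i => t i = t i₀).card :=
          Finset.card_pos.2 ⟨i₀, by simp⟩
        obtain ⟨k, hk⟩ := h1
        omega
      simpa using this
    have hle : I.card ≤ r := by omega
    have i00 : Fin (2 * r) := ⟨0, by omega⟩
    let e := I.equivFin
    refine ⟨fun i => Fin.castLE hle (e ⟨t i, Finset.mem_image_of_mem _ (Finset.mem_univ i)⟩),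
      fun j => if h : (j : ℕ) < I.card then (e.symm ⟨j, h⟩ : Fin B) else t i00, ?_⟩
    ext i
    simp
  refine (Finset.card_le_card hsub).trans (Finset.card_image_le.trans ?_)
  simp

/-- The `2r`-th moment of short character sums. -/
theorem exists_sum_short_pow_le (r : ℕ) (hr : 0 < r) :
    ∃ C : ℝ, 0 < C ∧ ∀ (p : ℕ) [Fact p.Prime], p ≠ 2 → ∀ B : ℕ, B ≤ p →
      ∑ x : ZMod p, (∑ b : Fin B, (quadraticChar (ZMod p) (x + (b : ℕ)) : ℝ)) ^ (2 * r) ≤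
        C * ((B : ℝ) ^ r * p + (B : ℝ) ^ (2 * r) * √p) := by
  classical
  obtain ⟨C, hC, hb⟩ := exists_sum_prod_quadraticChar_le r
  refine ⟨r ^ (2 * r) + C, by positivity, fun p _ hp2 B hB => ?_⟩
  simp only [Fintype.sum_pow]
  rw [Finset.sum_comm, ← Finset.sum_filter_add_sum_filter_not Finset.univ
    (fun t : Fin (2 * r) → Fin B => ∀ i₀, ¬ Odd (Finset.univ.filter fun i => t i = t i₀).card)]
  have habs : ∀ a : ZMod p, |(quadraticChar (ZMod p) a : ℝ)| ≤ 1 := by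
    intro a
    by_cases h0 : a = 0
    · simp [h0]
    · rcases quadraticChar_dichotomy h0 with h | h <;> simp [h]
  have h1 : ∀ t : Fin (2 * r) → Fin B,
      ∑ x : ZMod p, ∏ i, (quadraticChar (ZMod p) (x + ((t i : ℕ) : ZMod p)) : ℝ) ≤ p := by
    intro t
    calc _ ≤ ∑ x : ZMod p, (1 : ℝ) := by
          refine Finset.sum_le_sum fun x _ => (le_abs_self _).trans ?_
          rw [Finset.abs_prod]
          exact Finset.prod_le_one (fun _ _ => abs_nonneg _) fun _ _ => habs _
      _ = p := by simp
  have e1 := Finset.sum_le_card_nsmul (Finset.univ.filter fun t : Fin (2 * r) → Fin B =>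
      ∀ i₀, ¬ Odd (Finset.univ.filter fun i => t i = t i₀).card) _ (p : ℝ) (fun t _ => h1 t)
  have e2 := Finset.sum_le_card_nsmul (Finset.univ.filter fun t : Fin (2 * r) → Fin B =>
      ¬ ∀ i₀, ¬ Odd (Finset.univ.filter fun i => t i = t i₀).card)
      (fun t => ∑ x : ZMod p, ∏ i, (quadraticChar (ZMod p) (x + ((t i : ℕ) : ZMod p)) : ℝ))
      (C * √p) (by
        intro t ht
        simp only [Finset.mem_filter, Finset.mem_univ, true_and, not_forall, not_not] at ht
        obtain ⟨i₀, hi₀⟩ := ht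
        refine (le_abs_self _).trans (hb p hp2 (fun i => ((t i : ℕ) : ZMod p)) i₀ ?_)
        convert hi₀ using 4 with i
        constructor
        · intro h
          have := (ZMod.natCast_eq_natCast_iff' _ _ _).1 h
          rw [Nat.mod_eq_of_lt ((t i).2.trans_le hB), Nat.mod_eq_of_lt ((t i₀).2.trans_le hB)]
            at this
          exact Fin.ext this
        · intro h
          rw [h])
  refine (add_le_add e1 e2).trans ?_
  rw [nsmul_eq_mul, nsmul_eq_mul]
  have c1 := card_filter_fibers_even_le r B hr
  have c2 := Finset.card_filter_le (Finset.univ : Finset (Fin (2 * r) → Fin B))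
    (fun t => ¬ ∀ i₀, ¬ Odd (Finset.univ.filter fun i => t i = t i₀).card)
  simp only [Finset.card_univ, Fintype.card_pi, Fintype.card_fin, Finset.prod_const] at c2
  have c1R : ((Finset.univ.filter fun t : Fin (2 * r) → Fin B =>
      ∀ i₀, ¬ Odd (Finset.univ.filter fun i => t i = t i₀).card).card : ℝ) ≤
        (r : ℝ) ^ (2 * r) * (B : ℝ) ^ r := by exact_mod_cast c1
  have c2R : ((Finset.univ.filter fun t : Fin (2 * r) → Fin B =>
      ¬ ∀ i₀, ¬ Odd (Finset.univ.filter fun i => t i = t i₀).card).card : ℝ) ≤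
        (B : ℝ) ^ (2 * r) := by exact_mod_cast c2
  calc _ ≤ (r : ℝ) ^ (2 * r) * (B : ℝ) ^ r * p + (B : ℝ) ^ (2 * r) * (C * √p) := by
        gcongr
    _ ≤ _ := by
        have a1 : 0 ≤ C * ((B : ℝ) ^ r * p) := by positivity
        have a2 : 0 ≤ (r : ℝ) ^ (2 * r) * ((B : ℝ) ^ (2 * r) * √p) := by positivity
        linarith

lemma sum_card_divisors_le (N : ℕ) :
    (∑ k ∈ Finset.Ioc 0 N, (k.divisors.card : ℝ)) ≤ N * (1 + Real.log N) := by
  have h1 : ∀ k ∈ Finset.Ioc 0 N, (k.divisors.card : ℝ) =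
      ∑ d ∈ Finset.Ioc 0 N, if d ∣ k then 1 else 0 := by
    intro k hk
    rw [Finset.mem_Ioc] at hk
    rw [Finset.sum_boole]
    congr 2
    ext d
    simp only [Nat.mem_divisors, Finset.mem_filter, Finset.mem_Ioc]
    constructor
    · rintro ⟨h, h0⟩
      exact ⟨⟨Nat.pos_of_dvd_of_pos h hk.1, (Nat.le_of_dvd hk.1 h).trans hk.2⟩, h⟩
    · rintro ⟨-, h⟩
      exact ⟨h, hk.1.ne'⟩
  rw [Finset.sum_congr rfl h1, Finset.sum_comm]
  have h2 : ∀ d ∈ Finset.Ioc 0 N, (∑ k ∈ Finset.Ioc 0 N, if d ∣ k then (1 : ℝ) else 0) ≤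
      N * (d : ℝ)⁻¹ := by
    intro d _
    rw [Finset.sum_boole, Nat.Ioc_filter_dvd_card_eq_div, ← div_eq_mul_inv]
    exact Nat.cast_div_le
  refine (Finset.sum_le_sum h2).trans ?_
  rw [← Finset.mul_sum]
  refine mul_le_mul_of_nonneg_left ?_ (Nat.cast_nonneg _)
  refine le_trans (le_of_eq ?_) (harmonic_le_one_add_log N)
  rw [harmonic_eq_sum_Icc]
  push_cast
  rfl

lemma card_divisors_mul_le (m n : ℕ) :
    (m * n).divisors.card ≤ m.divisors.card * n.divisors.card := by
  rw [Nat.divisors_mul]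
  exact Finset.card_mul_le

/-- The number of integer solutions of `w u' = w' u` in a box. -/
lemma card_mul_eq_mul_le (A N : ℕ) :
    ((((Finset.Ioc 0 A ×ˢ Finset.Ioo (-N : ℤ) N) ×ˢ (Finset.Ioc 0 A ×ˢ Finset.Ioo (-N : ℤ) N)).filter
      fun q => q.1.2 * (q.2.1 : ℤ) = q.2.2 * (q.1.1 : ℤ)).card : ℝ) ≤
      (A : ℝ) ^ 2 + 2 * ((N * (1 + Real.log N)) * (A * (1 + Real.log A))) := by
  classical
  set Q := ((Finset.Ioc 0 A ×ˢ Finset.Ioo (-N : ℤ) N) ×ˢ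
    (Finset.Ioc 0 A ×ˢ Finset.Ioo (-N : ℤ) N)).filter
      fun q => q.1.2 * (q.2.1 : ℤ) = q.2.2 * (q.1.1 : ℤ) with hQ
  have hmem : ∀ q, q ∈ Q ↔ ((0 < q.1.1 ∧ q.1.1 ≤ A) ∧ (-N : ℤ) < q.1.2 ∧ q.1.2 < N) ∧
      ((0 < q.2.1 ∧ q.2.1 ≤ A) ∧ (-N : ℤ) < q.2.2 ∧ q.2.2 < N) ∧
      q.1.2 * (q.2.1 : ℤ) = q.2.2 * (q.1.1 : ℤ) := by
    intro q
    simp [hQ, and_assoc]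
  have h0 : (Q.filter fun q => q.1.2 = 0).card ≤ A ^ 2 := by
    have : (Q.filter fun q => q.1.2 = 0).card ≤ (Finset.Ioc 0 A ×ˢ Finset.Ioc 0 A).card := by
      refine Finset.card_le_card_of_injOn (fun q => (q.1.1, q.2.1)) ?_ ?_
      · intro q hq
        have hq' := Finset.mem_coe.1 hq
        rw [Finset.mem_filter, hmem] at hq'
        simp only [Finset.coe_product, Set.mem_prod, Finset.coe_Ioc, Set.mem_Ioc]
        exact ⟨hq'.1.1.1, hq'.1.2.1.1⟩
      · have hz : ∀ q ∈ Q.filter (fun q => q.1.2 = 0), q.1.2 = 0 ∧ q.2.2 = 0 := by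
          intro q hq
          rw [Finset.mem_filter, hmem] at hq
          obtain ⟨⟨h1, h2, h3⟩, h4⟩ := hq
          refine ⟨h4, ?_⟩
          rw [h4, zero_mul] at h3
          rcases mul_eq_zero.1 h3.symm with h | h
          · exact h
          · have := h1.1.1; omega
        rintro ⟨⟨a, b⟩, c, d⟩ hq ⟨⟨a', b'⟩, c', d'⟩ hq' h
        have e1 := hz _ hq
        have e2 := hz _ hq'
        simp only [Prod.mk.injEq] at h e1 e2 ⊢
        omega
    simpa [sq] using this
  have h1 : (Q.filter fun q => ¬ q.1.2 = 0).card ≤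
      2 * ((∑ w ∈ Finset.Ioc 0 N, w.divisors.card) * ∑ u ∈ Finset.Ioc 0 A, u.divisors.card) := by
    have : (Q.filter fun q => ¬ q.1.2 = 0).card ≤ ((Finset.univ : Finset Bool) ×ˢ
        (Finset.Ioc 0 N ×ˢ Finset.Ioc 0 A).sigma fun wu => (wu.1 * wu.2).divisors).card := by
      refine Finset.card_le_card_of_injOn
        (fun q => (decide (0 < q.1.2), ⟨(q.1.2.natAbs, q.2.1), q.1.1⟩)) ?_ ?_
      · intro q hq
        have hq' := Finset.mem_coe.1 hq
        rw [Finset.mem_filter, hmem] at hq'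
        obtain ⟨⟨h1, h2, h3⟩, h4⟩ := hq'
        simp only [Finset.mem_coe, Finset.mem_product, Finset.mem_univ, true_and,
          Finset.mem_sigma, Finset.mem_Ioc, Nat.mem_divisors]
        refine ⟨⟨⟨by omega, by omega⟩, h2.1⟩, ?_, ?_⟩
        · have := congrArg Int.natAbs h3
          rw [Int.natAbs_mul, Int.natAbs_mul, Int.natAbs_natCast, Int.natAbs_natCast] at this
          exact ⟨_, this.trans (mul_comm _ _)⟩
        · exact mul_ne_zero (by omega) (by omega)
      · rintro ⟨⟨a, b⟩, c, d⟩ hq ⟨⟨a', b'⟩, c', d'⟩ hq' h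
        have e1 := Finset.mem_coe.1 hq
        have e2 := Finset.mem_coe.1 hq'
        rw [Finset.mem_filter, hmem] at e1 e2
        simp only [Prod.mk.injEq, decide_eq_decide, Sigma.mk.injEq, heq_eq_eq] at h e1 e2 ⊢
        obtain ⟨hs, ⟨hb, rfl⟩, rfl⟩ := h
        have hbb : b = b' := by omega
        subst hbb
        refine ⟨⟨rfl, rfl⟩, rfl, ?_⟩
        have ha : (a : ℤ) ≠ 0 := by omega
        exact mul_right_cancel₀ ha (e1.1.2.2.symm.trans e2.1.2.2)
    refine this.trans ?_
    rw [Finset.card_product, Finset.card_sigma, Finset.card_univ, Fintype.card_bool,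
      Finset.sum_mul_sum, Finset.sum_product]
    gcongr with w _ u _
    exact card_divisors_mul_le w u
  have hc := Finset.card_filter_add_card_filter_not (s := Q) (fun q => q.1.2 = 0)
  have h0R : ((Q.filter fun q => q.1.2 = 0).card : ℝ) ≤ (A : ℝ) ^ 2 := by exact_mod_cast h0
  have h1R : ((Q.filter fun q => ¬ q.1.2 = 0).card : ℝ) ≤
      2 * ((∑ w ∈ Finset.Ioc 0 N, (w.divisors.card : ℝ)) *
        ∑ u ∈ Finset.Ioc 0 A, (u.divisors.card : ℝ)) := by exact_mod_cast h1
  rw [← hc, Nat.cast_add]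
  refine add_le_add h0R (h1R.trans ?_)
  refine mul_le_mul_of_nonneg_left ?_ (by norm_num)
  exact mul_le_mul (sum_card_divisors_le N) (sum_card_divisors_le A)
    (Finset.sum_nonneg fun _ _ => Nat.cast_nonneg _)
    ((Finset.sum_nonneg fun _ _ => Nat.cast_nonneg _).trans (sum_card_divisors_le N))

/-- The number of ways of writing `x` as `(c + n) / a` with `0 < a ≤ A` and `n < N`. -/
noncomputable def quotRep {p : ℕ} [Fact p.Prime] (c : ZMod p) (A N : ℕ) (x : ZMod p) : ℕ :=
  ((Finset.Ioc 0 A ×ˢ Finset.range N).filter fun z => (c + (z.2 : ZMod p)) / (z.1 : ZMod p) = x).card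

/-- The second moment of the number of representations as a quotient. -/
lemma sum_quotRep_sq_le {p : ℕ} [Fact p.Prime] (c : ZMod p) {A N : ℕ} (hA : 0 < A) (hAN : A ≤ N)
    (h2 : 2 * (A * N) < p) :
    ∑ x, (quotRep c A N x : ℝ) ^ 2 ≤ 8 * (A * N) * (1 + Real.log p) ^ 2 := by
  classical
  have hNp : N < p := by nlinarith
  have hAp : A < p := by omega
  let W : ZMod p → Finset (ℕ × ℤ) := fun x =>
    (Finset.Ioc 0 A ×ˢ Finset.Ioo (-N : ℤ) N).filter fun z => (z.2 : ZMod p) = z.1 * x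
  have hcast : ∀ a : ℕ, 0 < a → a ≤ A → (a : ZMod p) ≠ 0 := by
    intro a h0 h1 h
    rw [ZMod.natCast_eq_zero_iff] at h
    have := Nat.le_of_dvd h0 h
    omega
  have hν : ∀ x, 0 < quotRep c A N x → quotRep c A N x ≤ 1 + (W x).card := by
    intro x hx
    rw [quotRep, Finset.card_pos] at hx
    set Fx := (Finset.Ioc 0 A ×ˢ Finset.range N).filter
      fun z => (c + (z.2 : ZMod p)) / (z.1 : ZMod p) = x with hFx
    have hF : ∀ z ∈ Fx, (0 < z.1 ∧ z.1 ≤ A) ∧ z.2 < N ∧ c + (z.2 : ZMod p) = z.1 * x := by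
      intro z hz
      simp only [hFx, Finset.mem_filter, Finset.mem_product, Finset.mem_Ioc,
        Finset.mem_range] at hz
      refine ⟨hz.1.1, hz.1.2, ?_⟩
      rw [div_eq_iff (hcast _ hz.1.1.1 hz.1.1.2)] at hz
      rw [hz.2, mul_comm]
    obtain ⟨z₀, hz₀, hmin⟩ := Finset.exists_min_image Fx Prod.fst hx
    have hinj : ∀ z ∈ Fx, ∀ z' ∈ Fx, z.1 = z'.1 → z = z' := by
      intro z hz z' hz' h
      have e1 := hF z hz
      have e2 := hF z' hz'
      refine Prod.ext h ?_
      have : (z.2 : ZMod p) = z'.2 := by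
        have : c + (z.2 : ZMod p) = c + (z'.2 : ZMod p) := by rw [e1.2.2, e2.2.2, h]
        exact add_left_cancel this
      rw [ZMod.natCast_eq_natCast_iff', Nat.mod_eq_of_lt (by omega),
        Nat.mod_eq_of_lt (by omega)] at this
      exact this
    have hcard : (Fx.erase z₀).card ≤ (W x).card := by
      refine Finset.card_le_card_of_injOn (fun z => (z.1 - z₀.1, (z.2 : ℤ) - z₀.2)) ?_ ?_
      · intro z hz
        have hz' := Finset.mem_erase.1 (Finset.mem_coe.1 hz)
        have e1 := hF z hz'.2
        have e2 := hF z₀ hz₀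
        have e3 := hmin z hz'.2
        have e4 : z.1 ≠ z₀.1 := fun h => hz'.1 (hinj z hz'.2 z₀ hz₀ h)
        simp only [W, Finset.mem_coe, Finset.mem_filter, Finset.mem_product, Finset.mem_Ioc,
          Finset.mem_Ioo]
        refine ⟨⟨⟨by omega, by omega⟩, by omega, by omega⟩, ?_⟩
        rw [Nat.cast_sub e3]
        push_cast
        linear_combination e1.2.2 - e2.2.2
      · intro z hz z' hz' h
        have hz1 := (Finset.mem_erase.1 (Finset.mem_coe.1 hz)).2
        have hz2 := (Finset.mem_erase.1 (Finset.mem_coe.1 hz')).2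
        have e1 := hmin z hz1
        have e2 := hmin z' hz2
        simp only [Prod.mk.injEq] at h
        exact hinj z hz1 z' hz2 (by omega)
    rw [Finset.card_erase_of_mem hz₀] at hcard
    have hq : quotRep c A N x = Fx.card := rfl
    have := Finset.card_pos.2 hx
    omega
  have hsum1 : ∑ x, quotRep c A N x = A * N := by
    have := Finset.card_eq_sum_card_fiberwise (s := Finset.Ioc 0 A ×ˢ Finset.range N)
      (t := (Finset.univ : Finset (ZMod p)))
      (f := fun z => (c + (z.2 : ZMod p)) / (z.1 : ZMod p)) (fun _ _ => by simp)
    simp only [Finset.card_product, Nat.card_Ioc, Finset.card_range, tsub_zero] at this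
    exact this.symm
  have hW : ∑ x, (W x).card ^ 2 ≤ ((((Finset.Ioc 0 A ×ˢ Finset.Ioo (-N : ℤ) N) ×ˢ
      (Finset.Ioc 0 A ×ˢ Finset.Ioo (-N : ℤ) N)).filter
      fun q => q.1.2 * (q.2.1 : ℤ) = q.2.2 * (q.1.1 : ℤ)).card) := by
    have hsq : ∀ x, (W x).card ^ 2 = (W x ×ˢ W x).card := fun x => by
      rw [Finset.card_product, sq]
    simp only [hsq]
    rw [← Finset.card_biUnion]
    · refine Finset.card_le_card fun q hq => ?_
      simp only [Finset.mem_biUnion, Finset.mem_univ, true_and, W, Finset.mem_product,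
        Finset.mem_filter, Finset.mem_Ioc, Finset.mem_Ioo] at hq ⊢
      obtain ⟨x, ⟨h1, h1x⟩, h3, h3x⟩ := hq
      refine ⟨⟨h1, h3⟩, ?_⟩
      have hmod : ((q.1.2 * (q.2.1 : ℤ) - q.2.2 * (q.1.1 : ℤ) : ℤ) : ZMod p) = 0 := by
        push_cast
        rw [h1x, h3x]
        ring
      rw [ZMod.intCast_zmod_eq_zero_iff_dvd] at hmod
      have hb : ∀ (w : ℤ) (u : ℕ), (-N : ℤ) < w ∧ w < N → 0 < u ∧ u ≤ A → |w * u| ≤ A * N := by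
        intro w u hw hu
        rw [abs_mul, mul_comm, Nat.abs_cast]
        exact mul_le_mul (by exact_mod_cast hu.2) (abs_le.2 ⟨by omega, by omega⟩)
          (abs_nonneg _) (by positivity)
      have habs : |q.1.2 * (q.2.1 : ℤ) - q.2.2 * (q.1.1 : ℤ)| < p := by
        refine (abs_sub _ _).trans_lt ?_
        have b1 := hb _ _ h1.2 h3.1
        have b2 := hb _ _ h3.2 h1.1
        zify at h2
        linarith
      exact sub_eq_zero.1 (Int.eq_zero_of_abs_lt_dvd hmod habs)
    · intro x _ y _ hxy
      rw [Function.onFun, Finset.disjoint_left]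
      intro q hq hq'
      simp only [W, Finset.mem_product, Finset.mem_filter, Finset.mem_Ioc] at hq hq'
      apply hxy
      have := hq.1.2.symm.trans hq'.1.2
      exact mul_left_cancel₀ (hcast _ hq.1.1.1.1 hq.1.1.1.2) this
  have hpt : ∀ x, (quotRep c A N x : ℝ) ^ 2 ≤ 2 * quotRep c A N x + 2 * (W x).card ^ 2 := by
    intro x
    rcases Nat.eq_zero_or_pos (quotRep c A N x) with h | h
    · rw [h]; simp
    · have h1 : (quotRep c A N x : ℝ) ≤ 1 + (W x).card := by exact_mod_cast hν x h
      have h2 : (1 : ℝ) ≤ quotRep c A N x := by exact_mod_cast h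
      nlinarith [sq_nonneg ((W x).card - 1 : ℝ)]
  have hQ := card_mul_eq_mul_le A N
  have hWR : ∑ x, ((W x).card : ℝ) ^ 2 ≤
      (A : ℝ) ^ 2 + 2 * ((N * (1 + Real.log N)) * (A * (1 + Real.log A))) := by
    refine le_trans ?_ hQ
    exact_mod_cast hW
  have hsum1R : ∑ x, (quotRep c A N x : ℝ) = A * N := by exact_mod_cast hsum1
  have hAR : (0 : ℝ) < A := by exact_mod_cast hA
  have hANR : (A : ℝ) ≤ N := by exact_mod_cast hAN
  have hA1 : (1 : ℝ) ≤ A := by exact_mod_cast hA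
  have l1 : Real.log A ≤ Real.log p := Real.log_le_log hAR (by exact_mod_cast hAp.le)
  have l2 : Real.log N ≤ Real.log p := Real.log_le_log (by linarith) (by exact_mod_cast hNp.le)
  have l3 : 0 ≤ Real.log A := Real.log_nonneg hA1
  have l4 : 0 ≤ Real.log N := Real.log_nonneg (by linarith)
  calc ∑ x, (quotRep c A N x : ℝ) ^ 2
      ≤ ∑ x, (2 * (quotRep c A N x : ℝ) + 2 * ((W x).card : ℝ) ^ 2) :=
        Finset.sum_le_sum fun x _ => hpt x
    _ = 2 * (A * N) + 2 * ∑ x, ((W x).card : ℝ) ^ 2 := by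
        rw [Finset.sum_add_distrib, ← Finset.mul_sum, ← Finset.mul_sum, hsum1R]
    _ ≤ 2 * (A * N) + 2 * ((A : ℝ) ^ 2 + 2 * ((N * (1 + Real.log N)) * (A * (1 + Real.log A)))) := by
        gcongr
    _ ≤ 2 * (A * N) + 2 * ((A : ℝ) * N +
          2 * ((N * (1 + Real.log p)) * (A * (1 + Real.log p)))) := by
        rw [sq]
        gcongr
    _ = 4 * (A * N) * 1 + 4 * (A * N) * (1 + Real.log p) ^ 2 := by ring
    _ ≤ 4 * (A * N) * (1 + Real.log p) ^ 2 + 4 * (A * N) * (1 + Real.log p) ^ 2 := by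
        have : (1 : ℝ) ≤ (1 + Real.log p) ^ 2 := one_le_pow₀ (by linarith)
        gcongr
    _ = _ := by ring

lemma abs_quadraticChar_le_one {F : Type*} [Field F] [Fintype F] [DecidableEq F] (a : F) :
    |(quadraticChar F a : ℝ)| ≤ 1 := by
  by_cases h0 : a = 0
  · simp [h0]
  · rcases quadraticChar_dichotomy h0 with h | h <;> simp [h]

lemma abs_sum_range_sub_sum_range_shift_le (u : ℕ → ℝ) (hu : ∀ n, |u n| ≤ 1) (N h : ℕ) :
    |∑ n ∈ Finset.range N, u n - ∑ n ∈ Finset.range N, u (n + h)| ≤ 2 * h := by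
  have e1 := Finset.sum_range_add u N h
  have e2 := Finset.sum_range_add u h N
  rw [add_comm h N] at e2
  simp only [add_comm h] at e2
  have b : ∀ v : ℕ → ℝ, (∀ n, |v n| ≤ 1) → |∑ n ∈ Finset.range h, v n| ≤ h := by
    intro v hv
    refine (Finset.abs_sum_le_sum_abs _ _).trans ?_
    refine (Finset.sum_le_sum fun n _ => hv n).trans ?_
    simp
  have b1 := abs_le.1 (b u hu)
  have b2 := abs_le.1 (b (fun n => u (N + n)) fun n => hu _)
  rw [abs_le]
  constructor <;> linarith

lemma mul_abs_sum_quadraticChar_le {p : ℕ} [Fact p.Prime] (c : ZMod p) (A B N : ℕ) (hAp : A < p) :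
    (A * B : ℝ) * |∑ n ∈ Finset.range N, (quadraticChar (ZMod p) (c + n) : ℝ)| ≤
      2 * (A * B : ℝ) ^ 2 + ∑ z ∈ Finset.Ioc 0 A ×ˢ Finset.range N,
        |∑ b : Fin B,
          (quadraticChar (ZMod p) ((c + (z.2 : ZMod p)) / (z.1 : ZMod p) + (b : ℕ)) : ℝ)| := by
  set S := ∑ n ∈ Finset.range N, (quadraticChar (ZMod p) (c + n) : ℝ) with hS
  set U : ℕ → ℕ → ℝ := fun a b =>
    ∑ n ∈ Finset.range N, (quadraticChar (ZMod p) (c + ((n + a * b : ℕ) : ZMod p)) : ℝ) with hU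
  have h1 : ∀ a b, |S - U a b| ≤ 2 * (a * b : ℕ) := fun a b =>
    abs_sum_range_sub_sum_range_shift_le (fun n => (quadraticChar (ZMod p) (c + n) : ℝ))
      (fun n => abs_quadraticChar_le_one _) N (a * b)
  have h2 : (A * B : ℝ) * S = ∑ a ∈ Finset.Ioc 0 A, ∑ b : Fin B, (S - U a b) +
      ∑ a ∈ Finset.Ioc 0 A, ∑ b : Fin B, U a b := by
    simp only [← Finset.sum_add_distrib, sub_add_cancel]
    simp [mul_assoc]
  have h3 : |∑ a ∈ Finset.Ioc 0 A, ∑ b : Fin B, (S - U a b)| ≤ 2 * (A * B : ℝ) ^ 2 := by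
    refine (Finset.abs_sum_le_sum_abs _ _).trans ?_
    have : ∀ a ∈ Finset.Ioc 0 A, |∑ b : Fin B, (S - U a b)| ≤ B * (2 * (A * B : ℝ)) := by
      intro a ha
      rw [Finset.mem_Ioc] at ha
      refine (Finset.abs_sum_le_sum_abs _ _).trans ?_
      refine (Finset.sum_le_card_nsmul Finset.univ (fun b : Fin B => |S - U a b|)
        (2 * (A * B : ℝ)) fun b _ => (h1 a b).trans ?_).trans ?_
      · push_cast
        have := b.2
        gcongr
        exact ha.2
      · simp
    refine (Finset.sum_le_sum this).trans (le_of_eq ?_)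
    simp
    ring
  have h4 : |∑ a ∈ Finset.Ioc 0 A, ∑ b : Fin B, U a b| ≤
      ∑ z ∈ Finset.Ioc 0 A ×ˢ Finset.range N,
        |∑ b : Fin B,
          (quadraticChar (ZMod p) ((c + (z.2 : ZMod p)) / (z.1 : ZMod p) + (b : ℕ)) : ℝ)| := by
    rw [Finset.sum_product]
    refine (Finset.abs_sum_le_sum_abs _ _).trans (Finset.sum_le_sum fun a ha => ?_)
    rw [Finset.mem_Ioc] at ha
    have ha0 : (a : ZMod p) ≠ 0 := by
      rw [Ne, ZMod.natCast_eq_zero_iff]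
      intro h
      have := Nat.le_of_dvd ha.1 h
      omega
    rw [hU, Finset.sum_comm]
    refine (Finset.abs_sum_le_sum_abs _ _).trans (Finset.sum_le_sum fun n _ => ?_)
    have : ∑ b : Fin B, (quadraticChar (ZMod p) (c + ((n + a * b : ℕ) : ZMod p)) : ℝ) =
        quadraticChar (ZMod p) (a : ZMod p) *
          ∑ b : Fin B, (quadraticChar (ZMod p) ((c + (n : ZMod p)) / (a : ZMod p) + (b : ℕ)) : ℝ) := by
      rw [Finset.mul_sum]
      refine Finset.sum_congr rfl fun b _ => ?_
      rw [← Int.cast_mul, ← map_mul]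
      congr 2
      push_cast
      field_simp
      ring
    rw [this, abs_mul]
    exact mul_le_of_le_one_left (abs_nonneg _) (abs_quadraticChar_le_one _)
  rw [← abs_of_nonneg (by positivity : (0 : ℝ) ≤ A * B), ← abs_mul, h2]
  rw [abs_of_nonneg (by positivity : (0 : ℝ) ≤ A * B)]
  exact (abs_add_le _ _).trans (add_le_add h3 h4)

lemma sum_pow_two_mul_le {p : ℕ} [Fact p.Prime] (c : ZMod p) (A N r : ℕ) (hr : 0 < r)
    (hAN : 0 < A * N) (g : ZMod p → ℝ) (hg : ∀ x, 0 ≤ g x) :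
    (∑ z ∈ Finset.Ioc 0 A ×ˢ Finset.range N, g ((c + (z.2 : ZMod p)) / (z.1 : ZMod p))) ^ (2 * r) ≤
      (A * N : ℝ) ^ (2 * (r - 1)) * ((∑ x, (quotRep c A N x : ℝ) ^ 2) * ∑ x, g x ^ (2 * r)) := by
  classical
  set Z := Finset.Ioc 0 A ×ˢ Finset.range N with hZ
  set φ : ℕ × ℕ → ZMod p := fun z => (c + (z.2 : ZMod p)) / (z.1 : ZMod p) with hφ
  have hcard : (Z.card : ℝ) = A * N := by simp [hZ]
  obtain ⟨k, rfl⟩ : ∃ k, r = k + 1 := ⟨r - 1, by omega⟩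
  have h1 := pow_sum_div_card_le_sum_pow (s := Z) (f := fun z => g (φ z)) (fun z _ => hg _) k
  have hpos : (0 : ℝ) < A * N := by exact_mod_cast hAN
  rw [hcard, div_le_iff₀ (by positivity)] at h1
  have h2 : ∑ z ∈ Z, g (φ z) ^ (k + 1) = ∑ x, (quotRep c A N x : ℝ) * g x ^ (k + 1) := by
    rw [← Finset.sum_fiberwise_of_maps_to (s := Z) (t := Finset.univ) (g := φ)
      (fun _ _ => Finset.mem_univ _)]
    refine Finset.sum_congr rfl fun x _ => ?_
    rw [Finset.sum_congr rfl (g := fun _ => g x ^ (k + 1))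
      (fun z hz => by rw [(Finset.mem_filter.1 hz).2]), Finset.sum_const, nsmul_eq_mul]
    rfl
  have h3 := Finset.sum_mul_sq_le_sq_mul_sq Finset.univ (fun x => (quotRep c A N x : ℝ))
    (fun x => g x ^ (k + 1))
  calc (∑ z ∈ Z, g (φ z)) ^ (2 * (k + 1)) = ((∑ z ∈ Z, g (φ z)) ^ (k + 1)) ^ 2 := by
        rw [← pow_mul, mul_comm]
    _ ≤ ((∑ z ∈ Z, g (φ z) ^ (k + 1)) * (A * N : ℝ) ^ k) ^ 2 :=
        pow_le_pow_left₀ (pow_nonneg (Finset.sum_nonneg fun _ _ => hg _) _) h1 2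
    _ = (A * N : ℝ) ^ (2 * k) * (∑ x, (quotRep c A N x : ℝ) * g x ^ (k + 1)) ^ 2 := by
        rw [h2, mul_pow, ← pow_mul, mul_comm k 2, mul_comm]
    _ ≤ _ := by
        have : k + 1 - 1 = k := rfl
        rw [this]
        refine mul_le_mul_of_nonneg_left (h3.trans (le_of_eq ?_)) (by positivity)
        congr 1
        refine Finset.sum_congr rfl fun x _ => ?_
        rw [← pow_mul, mul_comm]

/-- Burgess's inequality with free parameters `A` and `B`. -/
lemma exists_burgess_parametric (r : ℕ) (hr : 0 < r) :
    ∃ C : ℝ, 0 < C ∧ ∀ (p : ℕ) [Fact p.Prime], p ≠ 2 → ∀ (c : ZMod p) (A B N : ℕ),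
      0 < A → A ≤ N → 2 * (A * N) < p → B ≤ p →
      ∃ T : ℝ, 0 ≤ T ∧
        (A * B : ℝ) * |∑ n ∈ Finset.range N, (quadraticChar (ZMod p) (c + n) : ℝ)| ≤
          2 * (A * B : ℝ) ^ 2 + T ∧
        T ^ (2 * r) ≤ C * (A * N : ℝ) ^ (2 * r - 1) * (1 + Real.log p) ^ 2 *
          ((B : ℝ) ^ r * p + (B : ℝ) ^ (2 * r) * √p) := by
  obtain ⟨C, hC, h⟩ := exists_sum_short_pow_le r hr
  refine ⟨8 * C, by positivity, fun p _ hp2 c A B N hA hAN h2 hB => ?_⟩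
  have hAp : A < p := by nlinarith
  have hANpos : 0 < A * N := Nat.mul_pos hA (by omega)
  refine ⟨_, Finset.sum_nonneg fun z _ => abs_nonneg _, mul_abs_sum_quadraticChar_le c A B N hAp, ?_⟩
  refine (sum_pow_two_mul_le c A N r hr hANpos (fun x =>
    |∑ b : Fin B, (quadraticChar (ZMod p) (x + (b : ℕ)) : ℝ)|) fun x => abs_nonneg _).trans ?_
  have e1 := sum_quotRep_sq_le c hA hAN h2
  have e2 := h p hp2 B hB
  have e3 : ∀ x : ZMod p, |∑ b : Fin B, (quadraticChar (ZMod p) (x + (b : ℕ)) : ℝ)| ^ (2 * r) =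
      (∑ b : Fin B, (quadraticChar (ZMod p) (x + (b : ℕ)) : ℝ)) ^ (2 * r) :=
    fun x => (even_two_mul r).pow_abs _
  simp only [e3]
  have e4 : (A * N : ℝ) ^ (2 * r - 1) = (A * N : ℝ) ^ (2 * (r - 1)) * (A * N) := by
    rw [← pow_succ]
    congr 1
    omega
  rw [e4]
  calc _ ≤ (A * N : ℝ) ^ (2 * (r - 1)) * ((8 * (A * N) * (1 + Real.log p) ^ 2) *
        (C * ((B : ℝ) ^ r * p + (B : ℝ) ^ (2 * r) * √p))) := by
        refine mul_le_mul_of_nonneg_left (mul_le_mul e1 e2 ?_ (by positivity)) (by positivity)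
        exact Finset.sum_nonneg fun x _ => (even_two_mul r).pow_nonneg _
    _ = _ := by ring

lemma one_add_log_sq_le {δ x : ℝ} (hδ : 0 < δ) (hx : 1 ≤ x) :
    (1 + Real.log x) ^ 2 ≤ (1 + 2 / δ) ^ 2 * x ^ δ := by
  have h1 : Real.log x ≤ x ^ (δ / 2) / (δ / 2) :=
    Real.log_le_rpow_div (by linarith) (by positivity)
  have h2 : 1 ≤ x ^ (δ / 2) := Real.one_le_rpow hx (by positivity)
  have h3 : x ^ δ = (x ^ (δ / 2)) ^ 2 := by
    rw [← Real.rpow_natCast, ← Real.rpow_mul (by linarith)]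
    congr 1
    push_cast
    ring
  rw [h3, ← mul_pow]
  have h4 : 0 ≤ Real.log x := Real.log_nonneg hx
  have h5 : x ^ (δ / 2) / (δ / 2) = 2 / δ * x ^ (δ / 2) := by field_simp
  refine pow_le_pow_left₀ (by linarith) ?_ 2
  rw [add_mul, one_mul]
  linarith

lemma abs_sum_range_quadraticChar_le {p : ℕ} [Fact p.Prime] (c : ZMod p) (N : ℕ) :
    |∑ n ∈ Finset.range N, (quadraticChar (ZMod p) (c + n) : ℝ)| ≤ N := by
  refine (Finset.abs_sum_le_sum_abs _ _).trans ?_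
  refine (Finset.sum_le_sum fun n _ => abs_quadraticChar_le_one _).trans ?_
  simp

set_option maxHeartbeats 1000000 in
/-- The numerical heart of the choice of parameters in Burgess's bound. -/
lemma burgess_numerics {ε : ℝ} (hε : 0 < ε) (hε4 : ε ≤ 1 / 4) {r : ℕ}
    (hr1 : 1 ≤ 2 * r * ε) (hr2 : 2 * r * ε ≤ 1 + 2 * ε) {C q Y A B N T : ℝ} (hC : 0 < C)
    (hq : 1 ≤ q) (hY : q ^ (1 / 4 + ε) ≤ Y) (hA : 0 < A)
    (hAY : Y * q ^ (-(0.6 * ε ^ 2) - 1 / (2 * (r : ℝ))) / 8 ≤ A)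
    (hB1 : q ^ (1 / (2 * (r : ℝ))) ≤ B) (hB2 : B ≤ 2 * q ^ (1 / (2 * (r : ℝ)))) (hN0 : 0 ≤ N)
    (hN : N ≤ Y)
    (hT : T ^ (2 * r) ≤ C * (A * N) ^ (2 * r - 1) * (1 + Real.log q) ^ 2 *
          (B ^ r * q + B ^ (2 * r) * √q)) :
    T ≤ max 1 (8 * C * (2 ^ r + 4 ^ r) * (1 + 2 / (0.05 * ε)) ^ 2) * Y ^ (1 - ε ^ 2) * (A * B) := by
  set C₁ := max 1 (8 * C * (2 ^ r + 4 ^ r) * (1 + 2 / (0.05 * ε)) ^ 2) with hC₁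
  have hr0 : (0 : ℝ) < r := by
    rcases Nat.eq_zero_or_pos r with h | h
    · rw [h] at hr1; norm_num at hr1
    · exact_mod_cast h
  have hrN : 0 < r := by exact_mod_cast hr0
  have hq0 : 0 < q := by linarith
  set u := 1 / (2 * (r : ℝ)) with hu
  have hru : 2 * r * u = 1 := by rw [hu]; field_simp
  have hu0 : 0 < u := by positivity
  have huε : u ≤ ε := by
    have : 2 * r * u ≤ 2 * r * ε := by linarith
    exact le_of_mul_le_mul_left this (by positivity)
  have hY0 : 0 < Y := (Real.rpow_pos_of_pos hq0 _).trans_le hY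
  have hB0 : 0 < B := (Real.rpow_pos_of_pos hq0 _).trans_le hB1
  have hC₁1 : 1 ≤ C₁ := le_max_left _ _
  set Z := Y ^ (1 - ε ^ 2) with hZ
  have hZ0 : 0 < Z := Real.rpow_pos_of_pos hY0 _
  have hL := one_add_log_sq_le (δ := 0.05 * ε) (by positivity) hq
  set K := (1 + 2 / (0.05 * ε)) ^ 2 with hK
  have hK0 : 0 < K := by positivity
  have hur : (q ^ u) ^ r = q ^ (1 / 2 : ℝ) := by
    rw [← Real.rpow_natCast, ← Real.rpow_mul hq0.le]
    congr 1
    linarith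
  have hu2r : (q ^ u) ^ (2 * r) = q := by
    rw [← Real.rpow_natCast, ← Real.rpow_mul hq0.le]
    push_cast
    rw [mul_comm, hru, Real.rpow_one]
  have hsq : √q = q ^ (1 / 2 : ℝ) := Real.sqrt_eq_rpow q
  have hBsum : B ^ r * q + B ^ (2 * r) * √q ≤ (2 ^ r + 4 ^ r) * (q ^ (1 / 2 : ℝ) * q) := by
    have b1 : B ^ r ≤ 2 ^ r * q ^ (1 / 2 : ℝ) := by
      rw [← hur, ← mul_pow]
      exact pow_le_pow_left₀ hB0.le hB2 _
    have b2 : B ^ (2 * r) ≤ 4 ^ r * q := by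
      calc B ^ (2 * r) ≤ (2 * q ^ u) ^ (2 * r) := pow_le_pow_left₀ hB0.le hB2 _
        _ = 4 ^ r * q := by rw [mul_pow, hu2r, pow_mul]; norm_num
    rw [hsq]
    calc _ ≤ 2 ^ r * q ^ (1 / 2 : ℝ) * q + 4 ^ r * q * q ^ (1 / 2 : ℝ) := by gcongr
      _ = _ := by ring
  have hBlow : q ≤ B ^ (2 * r) := by
    rw [← hu2r]
    exact pow_le_pow_left₀ (Real.rpow_nonneg hq0.le _) hB1 _
  have hrε : 2 * r * ε ^ 2 ≤ 1.5 * ε := by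
    calc 2 * r * ε ^ 2 = (2 * r * ε) * ε := by ring
      _ ≤ 1.5 * ε := mul_le_mul_of_nonneg_right (by linarith) hε.le
  have hexp0 : 0 ≤ 2 - 2 * r * ε ^ 2 := by linarith
  have hexp : 1 / 2 + 0.6 * ε ^ 2 + u + 0.05 * ε ≤ (1 / 4 + ε) * (2 - 2 * r * ε ^ 2) := by
    have h1 : ε * ε ≤ ε * (1 / 4) := mul_le_mul_of_nonneg_left hε4 hε.le
    have h2 : (1 / 4 + ε) * (2 * r * ε ^ 2) ≤ 1 / 2 * (1.5 * ε) :=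
      mul_le_mul (by linarith) hrε (by positivity) (by norm_num)
    rw [mul_sub, sq] at *
    linarith
  have hYexp : q ^ (1 / 2 + 0.6 * ε ^ 2 + u + 0.05 * ε) ≤ Y ^ (2 - 2 * r * ε ^ 2) := by
    calc _ ≤ q ^ ((1 / 4 + ε) * (2 - 2 * r * ε ^ 2)) :=
          Real.rpow_le_rpow_of_exponent_le hq hexp
      _ = (q ^ (1 / 4 + ε)) ^ (2 - 2 * r * ε ^ 2) := Real.rpow_mul hq0.le _ _
      _ ≤ _ := Real.rpow_le_rpow (Real.rpow_nonneg hq0.le _) hY hexp0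
  have hZ2r : Z ^ (2 * r) * Y = Y ^ (2 * r - 1) * Y ^ (2 - 2 * r * ε ^ 2) := by
    rw [hZ, ← Real.rpow_natCast _ (2 * r), ← Real.rpow_mul hY0.le,
      ← Real.rpow_natCast Y (2 * r - 1), ← Real.rpow_add hY0, ← Real.rpow_add_one hY0.ne']
    congr 1
    rw [Nat.cast_sub (by omega)]
    push_cast
    ring
  have hYA : Y ≤ 8 * A * q ^ (0.6 * ε ^ 2 + u) := by
    have h1 : q ^ (-(0.6 * ε ^ 2) - u) * q ^ (0.6 * ε ^ 2 + u) = 1 := by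
      rw [← Real.rpow_add hq0]
      ring_nf
      exact Real.rpow_zero q
    have h2 := mul_le_mul_of_nonneg_right hAY (Real.rpow_nonneg hq0.le (0.6 * ε ^ 2 + u))
    have h3 : Y * q ^ (-(0.6 * ε ^ 2) - u) / 8 * q ^ (0.6 * ε ^ 2 + u) = Y / 8 := by
      rw [mul_div_assoc, mul_assoc, div_mul_eq_mul_div, h1]
      ring
    linarith
  have hfin : C * (Y ^ (2 * r - 1) * (K * q ^ (0.05 * ε)) * ((2 ^ r + 4 ^ r) * q ^ (1 / 2 : ℝ))) ≤
      C₁ * Z ^ (2 * r) * A := by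
    refine le_of_mul_le_mul_right ?_ hY0
    have e1 : q ^ (0.05 * ε) * q ^ (1 / 2 : ℝ) * q ^ (0.6 * ε ^ 2 + u) =
        q ^ (1 / 2 + 0.6 * ε ^ 2 + u + 0.05 * ε) := by
      rw [← Real.rpow_add hq0, ← Real.rpow_add hq0]
      ring_nf
    calc _ ≤ C * (Y ^ (2 * r - 1) * (K * q ^ (0.05 * ε)) * ((2 ^ r + 4 ^ r) * q ^ (1 / 2 : ℝ))) *
          (8 * A * q ^ (0.6 * ε ^ 2 + u)) := by gcongr
      _ = (8 * C * (2 ^ r + 4 ^ r) * K) * A * Y ^ (2 * r - 1) *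
          (q ^ (0.05 * ε) * q ^ (1 / 2 : ℝ) * q ^ (0.6 * ε ^ 2 + u)) := by ring
      _ ≤ C₁ * A * Y ^ (2 * r - 1) * Y ^ (2 - 2 * r * ε ^ 2) := by
          rw [e1]
          gcongr
          exact le_max_right _ _
      _ = C₁ * A * (Z ^ (2 * r) * Y) := by rw [hZ2r]; ring
      _ = _ := by ring
  by_contra hcon
  push Not at hcon
  have hlt := pow_lt_pow_left₀ hcon (by positivity) (n := 2 * r) (by omega)
  have hchain : T ^ (2 * r) ≤ (C₁ * Z * (A * B)) ^ (2 * r) := by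
    have hA2r : A ^ (2 * r - 1) * A = A ^ (2 * r) := by
      rw [← pow_succ]; congr 1; omega
    calc T ^ (2 * r) ≤ C * (A * N) ^ (2 * r - 1) * (1 + Real.log q) ^ 2 *
          (B ^ r * q + B ^ (2 * r) * √q) := hT
      _ ≤ C * (A * Y) ^ (2 * r - 1) * (K * q ^ (0.05 * ε)) *
          ((2 ^ r + 4 ^ r) * (q ^ (1 / 2 : ℝ) * q)) := by gcongr
      _ = A ^ (2 * r - 1) * q * (C * (Y ^ (2 * r - 1) * (K * q ^ (0.05 * ε)) *
          ((2 ^ r + 4 ^ r) * q ^ (1 / 2 : ℝ)))) := by rw [mul_pow]; ring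
      _ ≤ A ^ (2 * r - 1) * B ^ (2 * r) * (C₁ * Z ^ (2 * r) * A) := by gcongr
      _ = C₁ * (Z ^ (2 * r) * (A ^ (2 * r) * B ^ (2 * r))) := by rw [← hA2r]; ring
      _ ≤ C₁ ^ (2 * r) * (Z ^ (2 * r) * (A ^ (2 * r) * B ^ (2 * r))) := by
          gcongr
          exact le_self_pow₀ hC₁1 (by omega)
      _ = _ := by rw [mul_pow, mul_pow, mul_pow]; ring
  exact absurd hlt (not_lt.2 hchain)

set_option maxHeartbeats 1000000 in
/-- Burgess's bound for quadratic character sums of length slightly above `p ^ (1 / 4)`. -/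
theorem exists_burgess_le {ε : ℝ} (hε : 0 < ε) (hε4 : ε ≤ 1 / 4) :
    ∃ C : ℝ, 0 < C ∧ ∀ (p : ℕ) [Fact p.Prime], p ≠ 2 → ∀ (c : ZMod p) (N : ℕ) (Y : ℝ),
      (N : ℝ) ≤ Y → (p : ℝ) ^ (1 / 4 + ε) ≤ Y → Y ≤ (p : ℝ) ^ (1 / 2 + ε / 3) →
      |∑ n ∈ Finset.range N, (quadraticChar (ZMod p) (c + n) : ℝ)| ≤ C * Y ^ (1 - ε ^ 2) := by
  set r := ⌈1 / (2 * ε)⌉₊ with hr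
  have hr1 : 1 ≤ 2 * r * ε := by
    have := Nat.le_ceil (1 / (2 * ε))
    rw [div_le_iff₀ (by positivity)] at this
    linarith
  have hr2 : 2 * r * ε ≤ 1 + 2 * ε := by
    have := (Nat.ceil_lt_add_one (by positivity : 0 ≤ 1 / (2 * ε))).le
    have h2 := mul_le_mul_of_nonneg_right this (by positivity : 0 ≤ 2 * ε)
    rw [add_mul, div_mul_cancel₀ _ (by positivity)] at h2
    linarith
  have hr0 : (0 : ℝ) < r := by
    rcases Nat.eq_zero_or_pos r with h | h
    · rw [h] at hr1; norm_num at hr1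
    · exact_mod_cast h
  have hrN : 0 < r := by exact_mod_cast hr0
  obtain ⟨C, hC, hmain⟩ := exists_burgess_parametric r hrN
  set C₁ := max 1 (8 * C * (2 ^ r + 4 ^ r) * (1 + 2 / (0.05 * ε)) ^ 2) with hC₁
  have hC₁1 : 1 ≤ C₁ := le_max_left _ _
  refine ⟨1024 + C₁, by positivity, fun p _ hp2 c N Y hNY hY1 hY2 => ?_⟩
  set q : ℝ := (p : ℝ) with hq
  have hq1 : 1 ≤ q := by rw [hq]; exact_mod_cast (Fact.out : p.Prime).one_lt.le
  have hq0 : 0 < q := by linarith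
  have hY1' : 1 ≤ Y := (Real.one_le_rpow hq1 (by positivity)).trans hY1
  have hY0 : 0 < Y := by linarith
  have hZ0 : 0 < Y ^ (1 - ε ^ 2) := Real.rpow_pos_of_pos hY0 _
  have htriv := abs_sum_range_quadraticChar_le c N
  have hYsplit : Y = Y ^ (ε ^ 2) * Y ^ (1 - ε ^ 2) := by
    rw [← Real.rpow_add hY0]
    ring_nf
    exact (Real.rpow_one Y).symm
  have hε2 : ε ^ 2 ≤ 1 / 16 := by nlinarith
  have hYε : Y ^ (ε ^ 2) ≤ q ^ (0.6 * ε ^ 2) := by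
    rw [Real.rpow_mul hq0.le]
    refine Real.rpow_le_rpow hY0.le (hY2.trans ?_) (by positivity)
    exact Real.rpow_le_rpow_of_exponent_le hq1 (by linarith)
  by_cases hsmall : q < 1024
  · have h1 : Y ^ (ε ^ 2) ≤ 1024 := by
      calc Y ^ (ε ^ 2) ≤ q ^ (0.6 * ε ^ 2) := hYε
        _ ≤ q ^ (1 : ℝ) := Real.rpow_le_rpow_of_exponent_le hq1 (by linarith)
        _ ≤ 1024 := by rw [Real.rpow_one]; exact hsmall.le
    calc _ ≤ (N : ℝ) := htriv
      _ ≤ Y ^ (ε ^ 2) * Y ^ (1 - ε ^ 2) := by rw [← hYsplit]; exact hNY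
      _ ≤ (1024 + C₁) * Y ^ (1 - ε ^ 2) := by gcongr; linarith
  push Not at hsmall
  by_cases hNZ : (N : ℝ) ≤ Y ^ (1 - ε ^ 2)
  · refine htriv.trans (hNZ.trans ?_)
    exact le_mul_of_one_le_left hZ0.le (by linarith)
  push Not at hNZ
  set u := 1 / (2 * (r : ℝ)) with hu
  have hru : 2 * r * u = 1 := by rw [hu]; field_simp
  have hu0 : 0 < u := by positivity
  have huε : u ≤ ε := by
    have : 2 * r * u ≤ 2 * r * ε := by linarith
    exact le_of_mul_le_mul_left this (by positivity)
  have huε2 : 2 / 3 * ε ≤ u := by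
    have : 2 * r * (2 / 3 * ε) ≤ 2 * r * u := by linarith
    exact le_of_mul_le_mul_left this (by positivity)
  have hu1 : u ≤ 1 := by linarith
  set B := ⌈q ^ u⌉₊ with hB
  have hqu1 : 1 ≤ q ^ u := Real.one_le_rpow hq1 hu0.le
  have hB1 : q ^ u ≤ B := Nat.le_ceil _
  have hB2 : (B : ℝ) ≤ 2 * q ^ u := by
    have := Nat.ceil_lt_add_one (by positivity : 0 ≤ q ^ u)
    linarith
  have hBp : B ≤ p := by
    refine Nat.ceil_le.2 ?_
    calc q ^ u ≤ q ^ (1 : ℝ) := Real.rpow_le_rpow_of_exponent_le hq1 hu1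
      _ = p := Real.rpow_one q
  set R := Y * q ^ (-(0.6 * ε ^ 2) - u) / 4 with hR
  have hfour : (4 : ℝ) ≤ q ^ (1 / 5 : ℝ) := by
    have : (4 : ℝ) = (1024 : ℝ) ^ (1 / 5 : ℝ) := by
      rw [show (1024 : ℝ) = 4 ^ (5 : ℝ) by norm_num, ← Real.rpow_mul (by norm_num)]
      norm_num
    rw [this]
    exact Real.rpow_le_rpow (by norm_num) hsmall (by norm_num)
  have hR1 : 1 ≤ R := by
    rw [hR, le_div_iff₀ (by norm_num), one_mul]
    calc (4 : ℝ) ≤ q ^ (1 / 5 : ℝ) := hfour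
      _ ≤ q ^ ((1 / 4 + ε) + (-(0.6 * ε ^ 2) - u)) :=
          Real.rpow_le_rpow_of_exponent_le hq1 (by linarith)
      _ = q ^ (1 / 4 + ε) * q ^ (-(0.6 * ε ^ 2) - u) := Real.rpow_add hq0 _ _
      _ ≤ _ := by gcongr
  set A := ⌊R⌋₊ with hA
  have hA0 : 0 < A := Nat.floor_pos.2 hR1
  have hAR : (A : ℝ) ≤ R := Nat.floor_le (by linarith)
  have hA1 : (1 : ℝ) ≤ A := by exact_mod_cast hA0
  have hAlow : R / 2 ≤ A := by
    have := Nat.lt_floor_add_one R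
    linarith
  have hqκ : Y * q ^ (-(0.6 * ε ^ 2)) ≤ Y ^ (1 - ε ^ 2) := by
    have h1 : q ^ (-(0.6 * ε ^ 2)) * Y ^ (ε ^ 2) ≤ 1 := by
      calc _ ≤ q ^ (-(0.6 * ε ^ 2)) * q ^ (0.6 * ε ^ 2) := by gcongr
        _ = 1 := by rw [← Real.rpow_add hq0, neg_add_cancel, Real.rpow_zero]
    calc Y * q ^ (-(0.6 * ε ^ 2)) = (Y ^ (ε ^ 2) * Y ^ (1 - ε ^ 2)) * q ^ (-(0.6 * ε ^ 2)) := by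
          rw [← hYsplit]
      _ = (q ^ (-(0.6 * ε ^ 2)) * Y ^ (ε ^ 2)) * Y ^ (1 - ε ^ 2) := by ring
      _ ≤ 1 * Y ^ (1 - ε ^ 2) := by gcongr
      _ = _ := one_mul _
  have hRu : R * q ^ u = Y * q ^ (-(0.6 * ε ^ 2)) / 4 := by
    rw [hR, div_mul_eq_mul_div, mul_assoc, ← Real.rpow_add hq0, sub_add_cancel]
  have hAN : A ≤ N := by
    have : (A : ℝ) ≤ N := by
      calc (A : ℝ) ≤ R * 1 := by linarith
        _ ≤ R * q ^ u := by gcongr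
        _ = Y * q ^ (-(0.6 * ε ^ 2)) / 4 := hRu
        _ ≤ Y ^ (1 - ε ^ 2) := by linarith
        _ ≤ N := hNZ.le
    exact_mod_cast this
  have hANp : 2 * (A * N) < p := by
    have : (2 * (A * N) : ℝ) < q := by
      have h1 : Y * Y * q ^ (-(0.6 * ε ^ 2) - u) ≤ q := by
        calc Y * Y * q ^ (-(0.6 * ε ^ 2) - u) ≤ q ^ (1 / 2 + ε / 3) * q ^ (1 / 2 + ε / 3) *
              q ^ (-(0.6 * ε ^ 2) - u) := by gcongr
          _ = q ^ ((1 / 2 + ε / 3) + (1 / 2 + ε / 3) + (-(0.6 * ε ^ 2) - u)) := by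
              rw [← Real.rpow_add hq0, ← Real.rpow_add hq0]
          _ ≤ q ^ (1 : ℝ) := by
              refine Real.rpow_le_rpow_of_exponent_le hq1 ?_
              have : 0 ≤ ε ^ 2 := sq_nonneg ε
              linarith
          _ = q := Real.rpow_one q
      calc (2 * (A * N) : ℝ) ≤ 2 * (R * Y) := by gcongr
        _ = Y * Y * q ^ (-(0.6 * ε ^ 2) - u) / 2 := by rw [hR]; ring
        _ < q := by linarith
    rw [hq] at this
    exact_mod_cast this
  obtain ⟨T, hT0, hT1, hT2⟩ := hmain p hp2 c A B N hA0 hAN hANp hBp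
  have hB0 : (0 : ℝ) < B := by linarith
  have hAB : (0 : ℝ) < A * B := by positivity
  have hT3 := burgess_numerics hε hε4 hr1 hr2 hC hq1 hY1 (by positivity : (0 : ℝ) < A)
    (by rw [← hu]; linarith) hB1 hB2 (Nat.cast_nonneg N) hNY hT2
  have h2AB : 2 * (A * B : ℝ) ≤ Y ^ (1 - ε ^ 2) := by
    calc 2 * (A * B : ℝ) ≤ 2 * (R * (2 * q ^ u)) := by gcongr
      _ = 4 * (R * q ^ u) := by ring
      _ = Y * q ^ (-(0.6 * ε ^ 2)) := by rw [hRu]; ring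
      _ ≤ _ := hqκ
  refine le_of_mul_le_mul_left ?_ hAB
  calc _ ≤ 2 * (A * B : ℝ) ^ 2 + T := hT1
    _ ≤ (2 * (A * B : ℝ)) * (A * B) + C₁ * Y ^ (1 - ε ^ 2) * (A * B) := by
        have h1 : 2 * (A * B : ℝ) ^ 2 = (2 * (A * B : ℝ)) * (A * B) := by ring
        rw [h1]
        exact add_le_add_right hT3 _
    _ ≤ Y ^ (1 - ε ^ 2) * (A * B) + C₁ * Y ^ (1 - ε ^ 2) * (A * B) := by gcongr
    _ ≤ A * B * ((1024 + C₁) * Y ^ (1 - ε ^ 2)) := by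
        have : 0 ≤ Y ^ (1 - ε ^ 2) * (A * B : ℝ) := by positivity
        nlinarith

lemma inv_norm_stdAddChar_sub_one_le {p : ℕ} [Fact p.Prime] {a : ZMod p} (ha : a ≠ 0) :
    ‖(ZMod.stdAddChar a : ℂ) - 1‖⁻¹ ≤ p / 4 * ((a.val : ℝ)⁻¹ + ((-a).val : ℝ)⁻¹) := by
  have hp0 : (0 : ℝ) < p := by exact_mod_cast (Fact.out : p.Prime).pos
  have hv0 : 0 < a.val := ZMod.val_pos.2 ha
  have hvp : a.val < p := ZMod.val_lt a
  have hv0' : (0 : ℝ) < a.val := by exact_mod_cast hv0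
  have hneg : ((-a).val : ℝ) = p - a.val := by
    have : NeZero a := ⟨ha⟩
    rw [ZMod.val_neg_of_ne_zero, Nat.cast_sub hvp.le]
  have hpv : (0 : ℝ) < p - a.val := by
    have : (a.val : ℝ) < p := by exact_mod_cast hvp
    linarith
  have hnorm : ‖(ZMod.stdAddChar a : ℂ) - 1‖ = |2 * Real.sin (Real.pi * a.val / p)| := by
    rw [ZMod.stdAddChar_apply, ZMod.toCircle_apply]
    have h := Complex.norm_exp_I_mul_ofReal_sub_one (2 * Real.pi * a.val / p)
    rw [Real.norm_eq_abs] at h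
    convert h using 4
    · push_cast
      ring
    · ring
  have hsin : 2 * min (a.val : ℝ) (p - a.val) / p ≤ Real.sin (Real.pi * a.val / p) := by
    rcases le_total (a.val : ℝ) (p - a.val) with h | h
    · rw [min_eq_left h]
      have := Real.mul_le_sin (x := Real.pi * a.val / p) (by positivity)
        (by rw [div_le_iff₀ hp0]; nlinarith [Real.pi_pos])
      convert this using 1
      field_simp
    · rw [min_eq_right h]
      have := Real.mul_le_sin (x := Real.pi * (p - a.val) / p) (by positivity)
        (by rw [div_le_iff₀ hp0]; nlinarith [Real.pi_pos])
      rw [show Real.pi * (p - a.val) / p = Real.pi - Real.pi * a.val / p by field_simp,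
        Real.sin_pi_sub] at this
      convert this using 1
      field_simp
  have hmin : 0 < min (a.val : ℝ) (p - a.val) := lt_min hv0' hpv
  have hlow : 4 * min (a.val : ℝ) (p - a.val) / p ≤ ‖(ZMod.stdAddChar a : ℂ) - 1‖ := by
    rw [hnorm]
    refine le_trans ?_ (le_abs_self _)
    have : 4 * min (a.val : ℝ) (p - a.val) / p = 2 * (2 * min (a.val : ℝ) (p - a.val) / p) := by
      ring
    linarith
  refine (inv_anti₀ (by positivity) hlow).trans ?_
  rw [hneg, inv_div, div_mul_eq_div_div, div_eq_mul_inv]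
  refine mul_le_mul_of_nonneg_left ?_ (by positivity)
  rcases min_choice (a.val : ℝ) (p - a.val) with h | h <;> rw [h]
  · have := inv_pos.2 hpv
    linarith
  · have := inv_pos.2 hv0'
    linarith

lemma norm_geom_sum_le {z : ℂ} (hz : ‖z‖ = 1) (hz1 : z ≠ 1) (N : ℕ) :
    ‖∑ n ∈ Finset.range N, z ^ n‖ ≤ 2 * ‖z - 1‖⁻¹ := by
  rw [geom_sum_eq hz1, norm_div, div_eq_mul_inv]
  refine mul_le_mul_of_nonneg_right ?_ (by positivity)
  refine (norm_sub_le _ _).trans ?_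
  rw [norm_pow, hz]
  norm_num

lemma sum_inv_val_le (p : ℕ) [Fact p.Prime] :
    ∑ a : ZMod p, (a.val : ℝ)⁻¹ ≤ 1 + Real.log p := by
  have hp := (Fact.out : p.Prime)
  have h1 : ∑ a : ZMod p, (a.val : ℝ)⁻¹ = ∑ k ∈ Finset.range p, (k : ℝ)⁻¹ := by
    refine Finset.sum_bij (fun a _ => a.val) (fun a _ => Finset.mem_range.2 (ZMod.val_lt a))
      (fun a _ b _ h => ZMod.val_injective p h) (fun k hk => ⟨k, Finset.mem_univ _, ?_⟩)
      (fun a _ => rfl)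
    exact ZMod.val_cast_of_lt (Finset.mem_range.1 hk)
  rw [h1]
  have h2 : ∑ k ∈ Finset.range (p + 1), (k : ℝ)⁻¹ = harmonic p := by
    rw [Finset.sum_range_succ', harmonic]
    simp
  calc _ ≤ ∑ k ∈ Finset.range (p + 1), (k : ℝ)⁻¹ :=
        Finset.sum_le_sum_of_subset_of_nonneg (Finset.range_mono (Nat.le_succ p))
          fun _ _ _ => by positivity
    _ ≤ _ := by rw [h2]; exact harmonic_le_one_add_log p

/-- The Pólya–Vinogradov inequality for the quadratic character. -/
theorem abs_sum_range_quadraticChar_le_sqrt_mul_log {p : ℕ} [Fact p.Prime] (hp2 : p ≠ 2)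
    (c : ZMod p) (N : ℕ) :
    |∑ n ∈ Finset.range N, (quadraticChar (ZMod p) (c + n) : ℝ)| ≤
      √p * (1 + Real.log p) := by
  have hp := (Fact.out : p.Prime)
  have hp0 : (0 : ℝ) < p := by exact_mod_cast hp.pos
  have hchar : ringChar (ZMod p) ≠ 2 := by rwa [ZMod.ringChar_zmod_n]
  set χ : MulChar (ZMod p) ℂ := (quadraticChar (ZMod p)).ringHomComp (Int.castRingHom ℂ) with hχ
  set ψ : AddChar (ZMod p) ℂ := ZMod.stdAddChar with hψ
  have hprim : ψ.IsPrimitive := ZMod.isPrimitive_stdAddChar p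
  have hχq : χ.IsQuadratic := (quadraticChar_isQuadratic (ZMod p)).comp _
  have hχ1 : χ ≠ 1 := by
    rw [hχ, MulChar.ringHomComp_ne_one_iff (Int.cast_injective)]
    exact quadraticChar_ne_one hchar
  have hχapp (a : ZMod p) : χ a = ((quadraticChar (ZMod p) a : ℤ) : ℂ) := rfl
  have hτ : ‖gaussSum χ ψ‖ = √p := by
    have h := congrArg norm (gaussSum_sq hχ1 hχq hprim)
    rw [norm_pow, norm_mul, ZMod.card, Complex.norm_natCast] at h
    have h1 : ‖χ (-1)‖ = 1 := by
      rcases hχq (-1) with h' | h' | h'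
      · exact absurd h' ((isUnit_one.neg.map χ).ne_zero)
      · rw [h']; simp
      · rw [h']; simp
    rw [h1, one_mul] at h
    rw [← h, Real.sqrt_sq (norm_nonneg _)]
  have hshift (n : ZMod p) : gaussSum χ ψ * χ n = ∑ a, χ a * ψ (a * n) := by
    rcases eq_or_ne n 0 with rfl | hn
    · simp [MulChar.map_zero, MulChar.sum_eq_zero_of_ne_one hχ1]
    · have h := gaussSum_mulShift χ ψ (Units.mk0 n hn)
      have hsq : χ n * χ n = 1 := by
        rcases hχq n with h' | h' | h'
        · exact absurd h' (((isUnit_iff_ne_zero.2 hn).map χ).ne_zero)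
        · rw [h']; simp
        · rw [h']; simp
      rw [← h, Units.val_mk0, mul_comm, ← mul_assoc, hsq, one_mul, gaussSum]
      exact Finset.sum_congr rfl fun a _ => by rw [AddChar.mulShift_apply, mul_comm a]
  have hsum : gaussSum χ ψ * ∑ n ∈ Finset.range N, χ (c + n) =
      ∑ a, χ a * ψ (a * c) * ∑ n ∈ Finset.range N, ψ a ^ n := by
    simp_rw [Finset.mul_sum, hshift]
    rw [Finset.sum_comm]
    refine Finset.sum_congr rfl fun a _ => Finset.sum_congr rfl fun n _ => ?_
    rw [mul_add, AddChar.map_add_eq_mul, ← AddChar.map_nsmul_eq_pow, nsmul_eq_mul,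
      mul_comm a n, mul_assoc]
  have hψnorm (a : ZMod p) : ‖ψ a‖ = 1 := AddChar.norm_apply ψ a
  have hterm (a : ZMod p) : ‖χ a * ψ (a * c) * ∑ n ∈ Finset.range N, ψ a ^ n‖ ≤
      p / 2 * ((a.val : ℝ)⁻¹ + ((-a).val : ℝ)⁻¹) := by
    rcases eq_or_ne a 0 with rfl | ha
    · simp [MulChar.map_zero]
    rw [norm_mul, norm_mul, hψnorm, mul_one]
    have h1 : ‖χ a‖ ≤ 1 := by
      rcases hχq a with h' | h' | h' <;> rw [h'] <;> simp
    have hψ1 : ψ a ≠ 1 := by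
      rw [hψ, ← (ZMod.stdAddChar (N := p)).map_zero_eq_one]
      exact fun h => ha (ZMod.injective_stdAddChar h)
    calc _ ≤ 1 * (2 * ‖ψ a - 1‖⁻¹) := by
          gcongr
          exact norm_geom_sum_le (hψnorm a) hψ1 N
      _ ≤ 1 * (2 * (p / 4 * ((a.val : ℝ)⁻¹ + ((-a).val : ℝ)⁻¹))) := by
          gcongr
          exact inv_norm_stdAddChar_sub_one_le ha
      _ = _ := by ring
  have htot : √p * ‖∑ n ∈ Finset.range N, χ (c + n)‖ ≤ p * (1 + Real.log p) := by
    rw [← hτ, ← norm_mul, hsum]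
    have hneg : ∑ a : ZMod p, ((-a).val : ℝ)⁻¹ = ∑ a : ZMod p, (a.val : ℝ)⁻¹ :=
      Equiv.sum_comp (Equiv.neg (ZMod p)) fun a => (a.val : ℝ)⁻¹
    calc _ ≤ ∑ a : ZMod p, p / 2 * ((a.val : ℝ)⁻¹ + ((-a).val : ℝ)⁻¹) :=
          norm_sum_le_of_le _ fun a _ => hterm a
      _ = p * ∑ a : ZMod p, (a.val : ℝ)⁻¹ := by
          rw [← Finset.mul_sum, Finset.sum_add_distrib, hneg]
          ring
      _ ≤ _ := mul_le_mul_of_nonneg_left (sum_inv_val_le p) hp0.le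
  have hcast : ‖∑ n ∈ Finset.range N, χ (c + n)‖ =
      |∑ n ∈ Finset.range N, (quadraticChar (ZMod p) (c + n) : ℝ)| := by
    rw [← Real.norm_eq_abs, ← Complex.norm_real]
    push_cast
    rfl
  rw [hcast] at htot
  have hs : 0 < √(p : ℝ) := Real.sqrt_pos.2 hp0
  refine le_of_mul_le_mul_left (htot.trans (le_of_eq ?_)) hs
  rw [← mul_assoc, Real.mul_self_sqrt hp0.le]

/-- The shape of our bounds for sums of a quadratic character over an interval of length `Y`,
with `P` playing the role of `p ^ (1 / 4 + ε)`. -/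
noncomputable def shortSumBound (ε P Y : ℝ) : ℝ :=
  (if ε ≤ 1 / 4 then Y ^ (1 - ε ^ 2) else 0) + min Y P

lemma shortSumBound_nonneg {ε P Y : ℝ} (hP : 0 ≤ P) (hY : 0 ≤ Y) : 0 ≤ shortSumBound ε P Y := by
  have := Real.rpow_nonneg hY (1 - ε ^ 2)
  have := le_min hY hP
  unfold shortSumBound
  split_ifs <;> linarith

lemma shortSumBound_mono {ε P Y Y' : ℝ} (hε : 0 < ε) (hY : 0 ≤ Y) (hYY' : Y ≤ Y') :
    shortSumBound ε P Y ≤ shortSumBound ε P Y' := by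
  unfold shortSumBound
  have h2 : min Y P ≤ min Y' P := min_le_min_right _ hYY'
  split_ifs with h
  · have := Real.rpow_le_rpow hY hYY' (z := 1 - ε ^ 2) (by nlinarith)
    linarith
  · linarith

lemma shortSumBound_mul_le {ε P Y k : ℝ} (hk : 1 ≤ k) (hP : 0 ≤ P) (hY : 0 ≤ Y) :
    shortSumBound ε P (k * Y) ≤ k * shortSumBound ε P Y := by
  unfold shortSumBound
  have h2 : min (k * Y) P ≤ k * min Y P := by
    rw [mul_min_of_nonneg _ _ (by linarith)]
    exact min_le_min_left _ (le_mul_of_one_le_left hP hk)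
  rw [mul_add]
  refine add_le_add ?_ h2
  split_ifs with h
  · rw [Real.mul_rpow (by linarith) hY]
    refine mul_le_mul_of_nonneg_right ?_ (Real.rpow_nonneg hY _)
    calc k ^ (1 - ε ^ 2) ≤ k ^ (1 : ℝ) :=
          Real.rpow_le_rpow_of_exponent_le hk (by nlinarith [sq_nonneg ε])
      _ = k := Real.rpow_one k
  · simp

lemma sqrt_mul_one_add_log_le {δ q : ℝ} (hδ : 0 < δ) (hq : 1 ≤ q) :
    √q * (1 + Real.log q) ≤ (1 + 1 / δ) * q ^ (1 / 2 + δ) := by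
  have hq0 : 0 < q := by linarith
  have h1 : Real.log q ≤ q ^ δ / δ := Real.log_le_rpow_div hq0.le hδ
  have h2 : 1 ≤ q ^ δ := Real.one_le_rpow hq hδ.le
  rw [Real.rpow_add hq0, ← Real.sqrt_eq_rpow]
  calc √q * (1 + Real.log q) ≤ √q * (q ^ δ + q ^ δ / δ) := by gcongr
    _ = _ := by ring

/-- A bound for incomplete quadratic character sums, uniform in the length. -/
theorem exists_abs_sum_range_quadraticChar_le_shortSumBound {ε : ℝ} (hε : 0 < ε) :
    ∃ C : ℝ, 0 < C ∧ ∀ (p : ℕ) [Fact p.Prime], p ≠ 2 → ∀ (c : ZMod p) (N : ℕ) (Y : ℝ),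
      0 < Y → (N : ℝ) ≤ Y →
      |∑ n ∈ Finset.range N, (quadraticChar (ZMod p) (c + n) : ℝ)| ≤
        C * shortSumBound ε ((p : ℝ) ^ (1 / 4 + ε)) Y := by
  by_cases hε4 : ε ≤ 1 / 4
  · obtain ⟨C, hC, hB⟩ := exists_burgess_le hε hε4
    refine ⟨C + 1 + (1 + 1 / (ε / 8)), by positivity, fun p _ hp2 c N Y hY hN => ?_⟩
    have hp1 : (1 : ℝ) ≤ p := by exact_mod_cast (Fact.out : p.Prime).one_lt.le
    have hK : 0 < 1 + 1 / (ε / 8) := by positivity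
    have hZ : 0 < Y ^ (1 - ε ^ 2) := Real.rpow_pos_of_pos hY _
    have hP : 0 < (p : ℝ) ^ (1 / 4 + ε) := Real.rpow_pos_of_pos (by linarith) _
    have hm : 0 < min Y ((p : ℝ) ^ (1 / 4 + ε)) := lt_min hY hP
    unfold shortSumBound
    rw [if_pos hε4]
    rcases lt_or_ge Y ((p : ℝ) ^ (1 / 4 + ε)) with h1 | h1
    · rw [min_eq_left h1.le]
      refine (abs_sum_range_quadraticChar_le c N).trans (hN.trans ?_)
      calc Y ≤ 1 * (Y ^ (1 - ε ^ 2) + Y) := by linarith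
        _ ≤ _ := by gcongr; linarith
    rcases le_or_gt Y ((p : ℝ) ^ (1 / 2 + ε / 3)) with h2 | h2
    · refine (hB p hp2 c N Y hN h1 h2).trans ?_
      gcongr <;> linarith
    · refine (abs_sum_range_quadraticChar_le_sqrt_mul_log hp2 c N).trans ?_
      refine (sqrt_mul_one_add_log_le (δ := ε / 8) (by positivity) hp1).trans ?_
      have h3 : (p : ℝ) ^ (1 / 2 + ε / 8) ≤ Y ^ (1 - ε ^ 2) := by
        have hsq : ε ^ 2 ≤ 1 / 4 * ε := by nlinarith
        calc (p : ℝ) ^ (1 / 2 + ε / 8) ≤ (p : ℝ) ^ ((1 / 2 + ε / 3) * (1 - ε ^ 2)) := by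
              refine Real.rpow_le_rpow_of_exponent_le hp1 ?_
              nlinarith
          _ = ((p : ℝ) ^ (1 / 2 + ε / 3)) ^ (1 - ε ^ 2) := Real.rpow_mul (by linarith) _ _
          _ ≤ _ := Real.rpow_le_rpow (by positivity) h2.le (by linarith)
      gcongr <;> linarith
  · push Not at hε4
    have hδ : 0 < ε - 1 / 4 := by linarith
    refine ⟨1 + 1 / (ε - 1 / 4), by positivity, fun p _ hp2 c N Y hY hN => ?_⟩
    have hp1 : (1 : ℝ) ≤ p := by exact_mod_cast (Fact.out : p.Prime).one_lt.le
    have h1 := abs_sum_range_quadraticChar_le_sqrt_mul_log hp2 c N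
    have h2 := sqrt_mul_one_add_log_le hδ hp1
    rw [show 1 / 2 + (ε - 1 / 4) = 1 / 4 + ε by ring] at h2
    unfold shortSumBound
    rw [if_neg (by linarith), zero_add, mul_min_of_nonneg _ _ (by positivity)]
    refine le_min ?_ (h1.trans h2)
    refine (abs_sum_range_quadraticChar_le c N).trans (hN.trans ?_)
    have h3 : 0 < 1 / (ε - 1 / 4) := by positivity
    exact le_mul_of_one_le_left hY.le (by linarith)

open ArithmeticFunction in
lemma sum_divisors_moebius (n : ℕ) :
    ∑ d ∈ n.divisors, moebius d = if n = 1 then 1 else 0 := by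
  have h := congrArg (fun f => f n) coe_zeta_mul_moebius
  rw [coe_zeta_mul_apply, one_apply] at h
  exact h

lemma sq_dvd_sq_mul_iff_of_squarefree {a b d : ℕ} (ha : Squarefree a) (hb : b ≠ 0) :
    d ^ 2 ∣ b ^ 2 * a ↔ d ∣ b := by
  refine ⟨fun h => ?_, fun h => (pow_dvd_pow_of_dvd h 2).mul_right a⟩
  obtain ⟨g, d', b', hg, hcop, rfl, rfl⟩ :=
    Nat.exists_coprime' (Nat.gcd_pos_of_pos_right d (Nat.pos_of_ne_zero hb))
  have h1 : d' ^ 2 ∣ b' ^ 2 * a := by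
    rw [mul_pow, mul_pow, mul_right_comm] at h
    exact Nat.dvd_of_mul_dvd_mul_right (pow_pos hg 2) h
  have h2 : d' ^ 2 ∣ a := (hcop.pow 2 2).dvd_of_dvd_mul_left h1
  have h3 : d' = 1 := Nat.isUnit_iff.1 (ha d' (by rwa [← sq]))
  rw [h3, one_mul]
  exact Dvd.intro_left b' rfl

lemma sum_moebius_of_sq_dvd {n M : ℕ} (hn : n ≠ 0) (hM : n < M) :
    ∑ d ∈ Finset.Ico 1 M, (if d ^ 2 ∣ n then ArithmeticFunction.moebius d else 0) =
      if Squarefree n then 1 else 0 := by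
  obtain ⟨a, b, rfl, ha⟩ := Nat.sq_mul_squarefree n
  have hb : b ≠ 0 := by
    rintro rfl
    simp at hn
  rw [← Finset.sum_filter]
  have hset : (Finset.Ico 1 M).filter (fun d => d ^ 2 ∣ b ^ 2 * a) = b.divisors := by
    ext d
    simp only [Finset.mem_filter, Finset.mem_Ico, Nat.mem_divisors,
      sq_dvd_sq_mul_iff_of_squarefree ha hb]
    refine ⟨fun h => ⟨h.2, hb⟩, fun h =>
      ⟨⟨Nat.pos_of_dvd_of_pos h.1 (Nat.pos_of_ne_zero hb), ?_⟩, h.1⟩⟩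
    have h1 : d ^ 2 ≤ b ^ 2 * a := Nat.le_of_dvd (Nat.pos_of_ne_zero hn)
      ((sq_dvd_sq_mul_iff_of_squarefree ha hb).2 h.1)
    exact (Nat.le_self_pow two_ne_zero d).trans_lt (h1.trans_lt hM)
  rw [hset, sum_divisors_moebius]
  congr 1
  refine propext ⟨fun h => by simpa [h] using ha, fun h => ?_⟩
  exact Nat.isUnit_iff.1 (h b ⟨a, by ring⟩)

lemma sum_moebius_of_dvd {n D : ℕ} (hD : D ≠ 0) :
    ∑ e ∈ D.divisors, (if e ∣ n then ArithmeticFunction.moebius e else 0) =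
      if n.Coprime D then 1 else 0 := by
  rw [← Finset.sum_filter]
  have hset : D.divisors.filter (fun e => e ∣ n) = (n.gcd D).divisors := by
    ext e
    simp only [Finset.mem_filter, Nat.mem_divisors, Nat.dvd_gcd_iff]
    have : n.gcd D ≠ 0 := Nat.gcd_ne_zero_right hD
    tauto
  rw [hset, sum_divisors_moebius]

/-- Quadratic character sums over multiples of `L` in a dyadic interval and in an odd residue
class modulo `4`. -/
lemma exists_sum_multiples_le {ε : ℝ} (hε : 0 < ε) :
    ∃ C : ℝ, 0 < C ∧ ∀ (p : ℕ) [Fact p.Prime], p ≠ 2 → ∀ (s L : ℕ) (X : ℝ),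
      s % 2 = 1 → 0 < L → 1 ≤ X →
      |∑ f ∈ (Finset.Ico ⌈X⌉₊ ⌈2 * X⌉₊).filter (fun f => f % 4 = s ∧ L ∣ f),
        (quadraticChar (ZMod p) f : ℝ)| ≤ C * shortSumBound ε ((p : ℝ) ^ (1 / 4 + ε)) (X / L) := by
  obtain ⟨C, hC, hmain⟩ := exists_abs_sum_range_quadraticChar_le_shortSumBound hε
  refine ⟨C * 4, by positivity, fun p _ hp2 s L X hs hL hX => ?_⟩
  have hp := (Fact.out : p.Prime)
  have hP : 0 ≤ (p : ℝ) ^ (1 / 4 + ε) := by positivity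
  have hL0 : (0 : ℝ) < L := by exact_mod_cast hL
  set Y := X / L with hY
  have hY0 : 0 < Y := by positivity
  have hXY : X = L * Y := by rw [hY]; field_simp
  by_cases hne : ∀ f ∈ Finset.Ico ⌈X⌉₊ ⌈2 * X⌉₊, ¬ (f % 4 = s ∧ L ∣ f)
  · rw [Finset.filter_false_of_mem hne, Finset.sum_empty, abs_zero]
    exact mul_nonneg (by positivity) (shortSumBound_nonneg hP hY0.le)
  push Not at hne
  obtain ⟨f₀, -, hf₀s, m₀, rfl⟩ := hne
  set a := m₀ % 4 with ha
  have hLodd : L % 2 = 1 := by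
    rcases Nat.mod_two_eq_zero_or_one L with h | h
    · have : L * m₀ % 2 = 0 := by rw [Nat.mul_mod, h]; simp
      omega
    · exact h
  have hs4 : s < 4 := by omega
  have hmod (m : ℕ) : L * m % 4 = s ↔ m % 4 = a := by
    rw [← hf₀s, ha]
    refine ⟨fun h => ?_, fun h => Nat.ModEq.mul_left L h⟩
    refine Nat.ModEq.cancel_left_of_coprime (c := L) ?_ h
    rw [Nat.gcd_comm]
    have : Nat.Coprime L (2 ^ 2) := Nat.Coprime.pow_right 2
      (Nat.coprime_two_right.2 (Nat.odd_iff.2 hLodd))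
    exact this
  have ha1 : 1 ≤ a := by
    rcases Nat.eq_zero_or_pos a with h | h
    · have : L * 0 % 4 = s := (hmod 0).2 (by rw [h])
      rw [mul_zero] at this
      omega
    · exact h
  have ha4 : a < 4 := Nat.mod_lt _ (by norm_num)
  set K₀ := ⌈(Y - a) / 4⌉₊ with hK₀
  set K₁ := ⌈(2 * Y - a) / 4⌉₊ with hK₁
  have hlow (k : ℕ) : X ≤ ((L * (4 * k + a) : ℕ) : ℝ) ↔ (Y - a) / 4 ≤ k := by
    rw [hXY, div_le_iff₀ (by norm_num)]
    push_cast
    rw [mul_le_mul_iff_right₀ hL0]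
    constructor <;> intro h <;> linarith
  have hupp (k : ℕ) : ((L * (4 * k + a) : ℕ) : ℝ) < 2 * X ↔ (k : ℝ) < (2 * Y - a) / 4 := by
    rw [hXY, lt_div_iff₀ (by norm_num), mul_left_comm]
    push_cast
    rw [mul_lt_mul_iff_right₀ hL0]
    constructor <;> intro h <;> linarith
  have hreindex : ∑ f ∈ (Finset.Ico ⌈X⌉₊ ⌈2 * X⌉₊).filter (fun f => f % 4 = s ∧ L ∣ f),
        (quadraticChar (ZMod p) f : ℝ) =
      ∑ k ∈ Finset.Ico K₀ K₁, (quadraticChar (ZMod p) ((L * (4 * k + a) : ℕ) : ZMod p) : ℝ) := by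
    symm
    refine Finset.sum_bij (fun k _ => L * (4 * k + a)) (fun k hk => ?_) (fun k _ k' _ h => ?_)
      (fun f hf => ?_) (fun k _ => rfl)
    · rw [Finset.mem_Ico, Nat.ceil_le, Nat.lt_ceil, ← hlow, ← hupp] at hk
      rw [Finset.mem_filter, Finset.mem_Ico, Nat.ceil_le, Nat.lt_ceil, hmod]
      exact ⟨hk, by omega, Dvd.intro _ rfl⟩
    · have := Nat.eq_of_mul_eq_mul_left hL h
      omega
    · rw [Finset.mem_filter, Finset.mem_Ico, Nat.ceil_le, Nat.lt_ceil] at hf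
      obtain ⟨hf1, hf2, m, rfl⟩ := hf
      rw [hmod] at hf2
      have hm : m = 4 * (m / 4) + a := by omega
      refine ⟨m / 4, ?_, by rw [← hm]⟩
      rw [Finset.mem_Ico, Nat.ceil_le, Nat.lt_ceil, ← hlow, ← hupp, ← hm]
      exact hf1
  have h4 : (4 : ZMod p) ≠ 0 := by
    have h2 : ((2 : ℕ) : ZMod p) ≠ 0 := by
      rw [Ne, ZMod.natCast_eq_zero_iff]
      intro h
      exact hp2 ((Nat.prime_dvd_prime_iff_eq hp Nat.prime_two).1 h)
    have : (4 : ZMod p) = ((2 : ℕ) : ZMod p) ^ 2 := by norm_num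
    rw [this]
    exact pow_ne_zero 2 h2
  have hfactor (i : ℕ) : (quadraticChar (ZMod p) ((L * (4 * (K₀ + i) + a) : ℕ) : ZMod p) : ℝ) =
      (quadraticChar (ZMod p) (4 * L) : ℝ) *
        (quadraticChar (ZMod p) ((K₀ + a / 4 : ZMod p) + i) : ℝ) := by
    rw [← Int.cast_mul, ← map_mul]
    congr 2
    push_cast
    field_simp
    ring
  have hK : ((K₁ - K₀ : ℕ) : ℝ) ≤ 4 * Y := by
    have h1 : ((K₁ - K₀ : ℕ) : ℝ) ≤ K₁ := by exact_mod_cast Nat.sub_le _ _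
    have ha1' : (1 : ℝ) ≤ a := by exact_mod_cast ha1
    rcases Nat.eq_zero_or_pos K₁ with h | h
    · rw [h, Nat.cast_zero] at h1
      rw [h]
      linarith
    · have h2 : 0 < (2 * Y - a) / 4 := Nat.ceil_pos.1 h
      have h3 := Nat.ceil_lt_add_one h2.le
      linarith
  rw [hreindex, Finset.sum_Ico_eq_sum_range]
  simp_rw [hfactor]
  rw [← Finset.mul_sum, abs_mul]
  calc _ ≤ 1 * (C * shortSumBound ε ((p : ℝ) ^ (1 / 4 + ε)) (4 * Y)) := by
        gcongr
        · exact abs_quadraticChar_le_one _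
        · exact hmain p hp2 _ _ _ (by positivity) hK
    _ ≤ 1 * (C * (4 * shortSumBound ε ((p : ℝ) ^ (1 / 4 + ε)) Y)) := by
        gcongr
        exact shortSumBound_mul_le (by norm_num) hP hY0.le
    _ = _ := by ring

/-- The sieve for squarefree integers coprime to `D`. -/
lemma exists_sum_squarefree_coprime_le {ε : ℝ} (hε : 0 < ε) :
    ∃ C : ℝ, 0 < C ∧ ∀ (p : ℕ) [Fact p.Prime], p ≠ 2 → ∀ (s D : ℕ) (X : ℝ),
      s % 2 = 1 → 0 < D → 1 ≤ X →
      |∑ f ∈ (Finset.Ico ⌈X⌉₊ ⌈2 * X⌉₊).filter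
          (fun f => f % 4 = s ∧ Squarefree f ∧ f.Coprime D),
        (quadraticChar (ZMod p) f : ℝ)| ≤ C * D.divisors.card *
          ∑ d ∈ Finset.Ico 1 ⌈2 * X⌉₊,
            shortSumBound ε ((p : ℝ) ^ (1 / 4 + ε)) (X / d ^ 2) := by
  obtain ⟨C, hC, hmain⟩ := exists_sum_multiples_le hε
  refine ⟨C, hC, fun p _ hp2 s D X hs hD hX => ?_⟩
  set M := ⌈2 * X⌉₊ with hM
  set I := Finset.Ico ⌈X⌉₊ M with hI
  have hP : 0 ≤ (p : ℝ) ^ (1 / 4 + ε) := by positivity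
  have hexpand : ∑ f ∈ I.filter (fun f => f % 4 = s ∧ Squarefree f ∧ f.Coprime D),
        (quadraticChar (ZMod p) f : ℝ) =
      ∑ d ∈ Finset.Ico 1 M, ∑ e ∈ D.divisors,
        ((ArithmeticFunction.moebius d * ArithmeticFunction.moebius e : ℤ) : ℝ) *
        ∑ f ∈ I.filter (fun f => f % 4 = s ∧ (d ^ 2).lcm e ∣ f),
          (quadraticChar (ZMod p) f : ℝ) := by
    have h1 : ∀ f ∈ I, (if f % 4 = s ∧ Squarefree f ∧ f.Coprime D then
          (quadraticChar (ZMod p) f : ℝ) else 0) =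
        ∑ d ∈ Finset.Ico 1 M, ∑ e ∈ D.divisors,
          ((ArithmeticFunction.moebius d * ArithmeticFunction.moebius e : ℤ) : ℝ) *
          (if f % 4 = s ∧ (d ^ 2).lcm e ∣ f then (quadraticChar (ZMod p) f : ℝ) else 0) := by
      intro f hf
      rw [hI, Finset.mem_Ico, Nat.ceil_le] at hf
      have hf0 : f ≠ 0 := by
        rintro rfl
        have := hf.1
        norm_num at this
        linarith
      have h2 := congrArg₂ (· * ·) (sum_moebius_of_sq_dvd hf0 hf.2)
        (sum_moebius_of_dvd (n := f) hD.ne')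
      simp only [Finset.sum_mul_sum] at h2
      have h3 : ∀ d e : ℕ, ((ArithmeticFunction.moebius d * ArithmeticFunction.moebius e : ℤ) : ℝ) *
          (if f % 4 = s ∧ (d ^ 2).lcm e ∣ f then (quadraticChar (ZMod p) f : ℝ) else 0) =
          (((if d ^ 2 ∣ f then ArithmeticFunction.moebius d else 0) *
            (if e ∣ f then ArithmeticFunction.moebius e else 0) : ℤ) : ℝ) *
          (if f % 4 = s then (quadraticChar (ZMod p) f : ℝ) else 0) := by
        intro d e
        simp only [Nat.lcm_dvd_iff]
        by_cases hd : d ^ 2 ∣ f <;> by_cases he : e ∣ f <;> by_cases h4 : f % 4 = s <;>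
          simp [hd, he, h4]
      simp_rw [h3, ← Finset.sum_mul, ← Int.cast_sum]
      rw [h2]
      by_cases hsq : Squarefree f <;> by_cases hc : f.Coprime D <;> by_cases h4 : f % 4 = s <;>
        simp [hsq, hc, h4]
    rw [Finset.sum_filter, Finset.sum_congr rfl h1, Finset.sum_comm]
    refine Finset.sum_congr rfl fun d _ => ?_
    rw [Finset.sum_comm]
    refine Finset.sum_congr rfl fun e _ => ?_
    rw [← Finset.mul_sum, Finset.sum_filter]
  rw [hexpand]
  have hterm : ∀ d ∈ Finset.Ico 1 M, ∀ e ∈ D.divisors,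
      |((ArithmeticFunction.moebius d * ArithmeticFunction.moebius e : ℤ) : ℝ) *
        ∑ f ∈ I.filter (fun f => f % 4 = s ∧ (d ^ 2).lcm e ∣ f),
          (quadraticChar (ZMod p) f : ℝ)| ≤
        C * shortSumBound ε ((p : ℝ) ^ (1 / 4 + ε)) (X / d ^ 2) := by
    intro d hd e he
    have hd0 : 0 < d := (Finset.mem_Ico.1 hd).1
    have he0 : 0 < e := Nat.pos_of_mem_divisors he
    have hμ : |((ArithmeticFunction.moebius d * ArithmeticFunction.moebius e : ℤ) : ℝ)| ≤ 1 := by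
      rw [← Int.cast_abs, abs_mul]
      exact_mod_cast mul_le_one₀ ArithmeticFunction.abs_moebius_le_one (abs_nonneg _)
        ArithmeticFunction.abs_moebius_le_one
    have hL : 0 < (d ^ 2).lcm e := Nat.lcm_pos (by positivity) he0
    have hdL : (d : ℝ) ^ 2 ≤ ((d ^ 2).lcm e : ℕ) := by
      exact_mod_cast Nat.le_of_dvd hL (Nat.dvd_lcm_left _ _)
    rw [abs_mul]
    calc _ ≤ 1 * (C * shortSumBound ε ((p : ℝ) ^ (1 / 4 + ε)) (X / ((d ^ 2).lcm e : ℕ))) := by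
          gcongr
          exact hmain p hp2 s _ X hs hL hX
      _ ≤ 1 * (C * shortSumBound ε ((p : ℝ) ^ (1 / 4 + ε)) (X / d ^ 2)) := by
          gcongr
          refine shortSumBound_mono hε (by positivity) ?_
          gcongr
      _ = _ := one_mul _
  calc _ ≤ ∑ d ∈ Finset.Ico 1 M, ∑ e ∈ D.divisors,
        C * shortSumBound ε ((p : ℝ) ^ (1 / 4 + ε)) (X / d ^ 2) :=
        (Finset.abs_sum_le_sum_abs _ _).trans (Finset.sum_le_sum fun d hd =>
          (Finset.abs_sum_le_sum_abs _ _).trans (Finset.sum_le_sum fun e he => hterm d hd e he))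
    _ = _ := by
        simp only [Finset.sum_const, nsmul_eq_mul]
        rw [Finset.mul_sum]
        exact Finset.sum_congr rfl fun d _ => by ring

lemma sum_min_div_sq_le {X P : ℝ} (hX : 0 < X) (hP : 0 < P) (M : ℕ) :
    ∑ d ∈ Finset.Ico 1 M, min (X / (d : ℝ) ^ 2) P ≤ 4 * √(X * P) := by
  set K := √(X / P) with hK
  have hK0 : 0 < K := Real.sqrt_pos.2 (by positivity)
  have hXK : X = P * K ^ 2 := by
    rw [hK, Real.sq_sqrt (by positivity)]
    field_simp
  have hPK : √(X * P) = P * K := by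
    rw [hXK, show P * K ^ 2 * P = (P * K) ^ 2 by ring, Real.sqrt_sq (by positivity)]
  set g : ℕ → ℝ := fun n => 4 * (P * K) * (n / (K + n)) with hg
  have hstep (n : ℕ) : min (X / ((1 + n : ℕ) : ℝ) ^ 2) P ≤ g (n + 1) - g n := by
    have hn : (0 : ℝ) ≤ n := Nat.cast_nonneg n
    have hdiff : g (n + 1) - g n = 4 * P * K ^ 2 / ((K + (n + 1)) * (K + n)) := by
      simp only [hg]
      push_cast
      field_simp
      ring
    have hle : 4 * P * K ^ 2 / (K + (n + 1)) ^ 2 ≤ g (n + 1) - g n := by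
      rw [hdiff]
      refine div_le_div_of_nonneg_left (by positivity) (by positivity) ?_
      rw [sq]
      exact mul_le_mul_of_nonneg_left (by linarith) (by positivity)
    refine le_trans ?_ hle
    push_cast
    rcases le_total K (n + 1) with h | h
    · refine (min_le_left _ _).trans ?_
      rw [hXK, div_le_div_iff₀ (by positivity) (by positivity)]
      have : (K + (n + 1)) ^ 2 ≤ (2 * (1 + n)) ^ 2 := pow_le_pow_left₀ (by positivity) (by linarith) 2
      calc P * K ^ 2 * (K + (n + 1)) ^ 2 ≤ P * K ^ 2 * (2 * (1 + n)) ^ 2 := by gcongr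
        _ = _ := by ring
    · refine (min_le_right _ _).trans ?_
      rw [le_div_iff₀ (by positivity)]
      have : (K + (n + 1)) ^ 2 ≤ (2 * K) ^ 2 := pow_le_pow_left₀ (by positivity) (by linarith) 2
      calc P * (K + (n + 1)) ^ 2 ≤ P * (2 * K) ^ 2 := by gcongr
        _ = _ := by ring
  rw [Finset.sum_Ico_eq_sum_range]
  refine (Finset.sum_le_sum fun n _ => hstep n).trans ?_
  rw [Finset.sum_range_sub, hPK]
  simp only [hg]
  have h1 : ((M - 1 : ℕ) : ℝ) / (K + (M - 1 : ℕ)) ≤ 1 := by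
    rw [div_le_one (by positivity)]
    linarith
  have h2 : 0 ≤ P * K := by positivity
  rw [Nat.cast_zero, zero_div, mul_zero, sub_zero]
  nlinarith

lemma exists_sum_shortSumBound_le {ε : ℝ} (hε : 0 < ε) :
    ∃ C : ℝ, 0 < C ∧ ∀ (X P : ℝ) (M : ℕ), 0 < X → 0 < P →
      ∑ d ∈ Finset.Ico 1 M, shortSumBound ε P (X / (d : ℝ) ^ 2) ≤
        C * (X ^ (1 - ε ^ 2) + √(X * P)) := by
  set S := ∑' n : ℕ, (n : ℝ) ^ (-(15 / 8) : ℝ) with hS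
  have hsummable : Summable fun n : ℕ => (n : ℝ) ^ (-(15 / 8) : ℝ) :=
    Real.summable_nat_rpow.2 (by norm_num)
  have hS0 : 0 ≤ S := tsum_nonneg fun n => by positivity
  refine ⟨S + 4, by positivity, fun X P M hX hP => ?_⟩
  have hfirst : ∑ d ∈ Finset.Ico 1 M,
      (if ε ≤ 1 / 4 then (X / (d : ℝ) ^ 2) ^ (1 - ε ^ 2) else 0) ≤ S * X ^ (1 - ε ^ 2) := by
    split_ifs with h
    · have hterm : ∀ d ∈ Finset.Ico 1 M, (X / (d : ℝ) ^ 2) ^ (1 - ε ^ 2) ≤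
          (d : ℝ) ^ (-(15 / 8) : ℝ) * X ^ (1 - ε ^ 2) := by
        intro d hd
        have hd1 : (1 : ℝ) ≤ d := by exact_mod_cast (Finset.mem_Ico.1 hd).1
        have hd0 : (0 : ℝ) < d := by linarith
        rw [Real.div_rpow hX.le (by positivity), div_eq_mul_inv, mul_comm,
          ← Real.rpow_neg (by positivity), ← Real.rpow_natCast, ← Real.rpow_mul hd0.le]
        refine mul_le_mul_of_nonneg_right ?_ (by positivity)
        refine Real.rpow_le_rpow_of_exponent_le hd1 ?_
        push_cast
        nlinarith
      refine (Finset.sum_le_sum hterm).trans ?_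
      rw [← Finset.sum_mul]
      exact mul_le_mul_of_nonneg_right (hsummable.sum_le_tsum _ fun n _ => by positivity)
        (by positivity)
    · rw [Finset.sum_const_zero]
      positivity
  have hsecond := sum_min_div_sq_le hX hP M
  have h1 : 0 ≤ S * √(X * P) := by positivity
  have h2 : 0 ≤ X ^ (1 - ε ^ 2) := by positivity
  unfold shortSumBound
  rw [Finset.sum_add_distrib]
  nlinarith

lemma isFundamentalDiscriminant_and_odd_iff (f : ℤ) :
    IsFundamentalDiscriminant f ∧ Odd f ↔ f % 4 = 1 ∧ Squarefree f := by
  unfold IsFundamentalDiscriminant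
  refine ⟨?_, fun h => ⟨Or.inl h, Int.odd_iff.2 (by omega)⟩⟩
  rintro ⟨h | ⟨m, hm, -⟩, hodd⟩
  · exact h
  · rw [Int.odd_iff] at hodd
    omega

/-- The odd fundamental discriminants split according to their sign. -/
lemma finsum_odd_fundamental_discriminant_eq (g : ℤ → ℝ) (D : ℕ) {X : ℝ} (hX : 0 < X) :
    ∑ᶠ f ∈ {f : ℤ | IsFundamentalDiscriminant f ∧ Odd f ∧ IsCoprime f (D : ℤ) ∧
        X ≤ |(f : ℝ)| ∧ |(f : ℝ)| < 2 * X}, g f =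
      ∑ f ∈ (Finset.Ico ⌈X⌉₊ ⌈2 * X⌉₊).filter
        (fun f => f % 4 = 1 ∧ Squarefree f ∧ f.Coprime D), g f +
      ∑ f ∈ (Finset.Ico ⌈X⌉₊ ⌈2 * X⌉₊).filter
        (fun f => f % 4 = 3 ∧ Squarefree f ∧ f.Coprime D), g (-f) := by
  set A := (Finset.Ico ⌈X⌉₊ ⌈2 * X⌉₊).filter
    (fun f => f % 4 = 1 ∧ Squarefree f ∧ f.Coprime D) with hA
  set B := (Finset.Ico ⌈X⌉₊ ⌈2 * X⌉₊).filter
    (fun f => f % 4 = 3 ∧ Squarefree f ∧ f.Coprime D) with hB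
  have hinjA : Set.InjOn (fun n : ℕ => (n : ℤ)) A := fun a _ b _ h => by simpa using h
  have hinjB : Set.InjOn (fun n : ℕ => -(n : ℤ)) B := fun a _ b _ h => by simpa using h
  have hset : {f : ℤ | IsFundamentalDiscriminant f ∧ Odd f ∧ IsCoprime f (D : ℤ) ∧
      X ≤ |(f : ℝ)| ∧ |(f : ℝ)| < 2 * X} =
      ((A.image (fun n : ℕ => (n : ℤ)) ∪ B.image (fun n : ℕ => -(n : ℤ)) : Finset ℤ) : Set ℤ) := by
    ext f
    rw [Set.mem_ofPred_eq, ← and_assoc, isFundamentalDiscriminant_and_odd_iff, Finset.coe_union,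
      Finset.coe_image, Finset.coe_image, Int.isCoprime_iff_gcd_eq_one, Int.gcd, Int.natAbs_natCast,
      ← Int.squarefree_natAbs, ← Int.cast_abs, Int.abs_eq_natAbs, Int.cast_natCast]
    simp only [Set.mem_union, Set.mem_image, Finset.mem_coe, hA, hB, Finset.mem_filter,
      Finset.mem_Ico, Nat.ceil_le, Nat.lt_ceil]
    constructor
    · rintro ⟨⟨h1, h2⟩, h3, h4, h5⟩
      rcases Int.natAbs_eq f with h | h
      · exact Or.inl ⟨f.natAbs, ⟨⟨h4, h5⟩, by omega, h2, h3⟩, h.symm⟩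
      · exact Or.inr ⟨f.natAbs, ⟨⟨h4, h5⟩, by omega, h2, h3⟩, h.symm⟩
    · rintro (⟨n, ⟨⟨h4, h5⟩, h1, h2, h3⟩, rfl⟩ | ⟨n, ⟨⟨h4, h5⟩, h1, h2, h3⟩, rfl⟩)
      · rw [Int.natAbs_natCast]
        exact ⟨⟨by omega, h2⟩, h3, h4, h5⟩
      · rw [Int.natAbs_neg, Int.natAbs_natCast]
        exact ⟨⟨by omega, h2⟩, h3, h4, h5⟩
  have hdisj : Disjoint (A.image (fun n : ℕ => (n : ℤ))) (B.image (fun n : ℕ => -(n : ℤ))) := by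
    rw [Finset.disjoint_left]
    intro f hf hf'
    obtain ⟨a, ha, rfl⟩ := Finset.mem_image.1 hf
    obtain ⟨b, hb, hab⟩ := Finset.mem_image.1 hf'
    rw [hA, Finset.mem_filter, Finset.mem_Ico] at ha
    have := Nat.ceil_pos.2 hX
    omega
  rw [hset, finsum_mem_coe_finset, Finset.sum_union hdisj, Finset.sum_image hinjA,
    Finset.sum_image hinjB]

/-- Burgess-type bound for sums of Legendre symbols over odd
fundamental discriminants. For every `ε > 0` there is `C(ε) > 0` such that for all
`D ≥ 1`, odd primes `p` and `X ≥ 1`,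
`|∑_f (f/p)| ≤ C(ε)·τ(D)·(X^{1−ε²} + X^{1/2}·p^{1/8+ε/2})`,
where `f` runs over odd fundamental discriminants coprime to `D` with `X ≤ |f| < 2X`. -/
theorem legendre_char_sum_odd_fund_disc (ε : ℝ) (hε : 0 < ε) :
    ∃ C : ℝ, 0 < C ∧ ∀ (D : ℕ), 0 < D → ∀ (p : ℕ) [Fact p.Prime], p ≠ 2 →
      ∀ X : ℝ, 1 ≤ X →
      |∑ᶠ f ∈ {f : ℤ | IsFundamentalDiscriminant f ∧ Odd f ∧ IsCoprime f (D : ℤ) ∧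
            X ≤ |(f : ℝ)| ∧ |(f : ℝ)| < 2 * X}, ((legendreSym p f : ℤ) : ℝ)|
        ≤ C * (D.divisors.card : ℝ) *
            (X ^ (1 - ε ^ 2) + X ^ ((1 : ℝ) / 2) * (p : ℝ) ^ ((1 : ℝ) / 8 + ε / 2)) := by
  obtain ⟨C₁, hC₁, h₁⟩ := exists_sum_squarefree_coprime_le hε
  obtain ⟨C₂, hC₂, h₂⟩ := exists_sum_shortSumBound_le hε
  refine ⟨2 * C₁ * C₂, by positivity, fun D hD p _ hp2 X hX => ?_⟩
  have hX0 : 0 < X := by linarith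
  have hp0 : (0 : ℝ) < p := by exact_mod_cast (Fact.out : p.Prime).pos
  have hsqrt : √(X * (p : ℝ) ^ (1 / 4 + ε)) =
      X ^ ((1 : ℝ) / 2) * (p : ℝ) ^ ((1 : ℝ) / 8 + ε / 2) := by
    rw [Real.sqrt_eq_rpow, Real.mul_rpow hX0.le (by positivity), ← Real.rpow_mul hp0.le]
    congr 2
    ring
  have hclass (s : ℕ) (hs : s % 2 = 1) :
      |∑ f ∈ (Finset.Ico ⌈X⌉₊ ⌈2 * X⌉₊).filter
          (fun f => f % 4 = s ∧ Squarefree f ∧ f.Coprime D),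
        (quadraticChar (ZMod p) f : ℝ)| ≤ C₁ * D.divisors.card *
          (C₂ * (X ^ (1 - ε ^ 2) + X ^ ((1 : ℝ) / 2) * (p : ℝ) ^ ((1 : ℝ) / 8 + ε / 2))) := by
    refine (h₁ p hp2 s D X hs hD hX).trans ?_
    rw [← hsqrt]
    exact mul_le_mul_of_nonneg_left (h₂ X _ _ hX0 (by positivity)) (by positivity)
  rw [finsum_odd_fundamental_discriminant_eq (fun f => ((legendreSym p f : ℤ) : ℝ)) D hX0]
  have hneg : ∑ f ∈ (Finset.Ico ⌈X⌉₊ ⌈2 * X⌉₊).filter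
        (fun f => f % 4 = 3 ∧ Squarefree f ∧ f.Coprime D), ((legendreSym p (-f : ℤ) : ℤ) : ℝ) =
      (quadraticChar (ZMod p) (-1) : ℝ) * ∑ f ∈ (Finset.Ico ⌈X⌉₊ ⌈2 * X⌉₊).filter
        (fun f => f % 4 = 3 ∧ Squarefree f ∧ f.Coprime D), (quadraticChar (ZMod p) f : ℝ) := by
    rw [Finset.mul_sum]
    refine Finset.sum_congr rfl fun f _ => ?_
    rw [legendreSym, ← Int.cast_mul, ← map_mul]
    push_cast
    rw [neg_one_mul]
  have hpos (f : ℕ) : ((legendreSym p (f : ℤ) : ℤ) : ℝ) = (quadraticChar (ZMod p) f : ℝ) := by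
    rw [legendreSym, Int.cast_natCast]
  simp only [hpos]
  rw [hneg]
  refine (abs_add_le _ _).trans ?_
  rw [abs_mul]
  have h3 := mul_le_mul (abs_quadraticChar_le_one (-1 : ZMod p)) (hclass 3 rfl) (abs_nonneg _)
    zero_le_one
  have h4 := hclass 1 rfl
  linarith
end
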